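/- arXiv:1612.08442 — 2 statements merged into one kernel-verified Lean document; each statement's English description precedes it below -/
import Mathlib

section
/- Let λ > 0 and 0 < δ < 1. Then for every integer n ≥ 1, ∫_{-1}^1 (arccos t)^δ C_n^λ(t) (1-t^2)^{λ-1/2} dt < 0. -/
/-- Gegenbauer polynomials via the standard three-term recurrence. -/
noncomputable def gegenbauer (l : ℝ) : ℕ → Polynomial ℝ
  | 0 => 1
  | 1 => Polynomial.C (2 * l) * Polynomial.X
  | (n + 2) =>
      Polynomial.C ((2 * ((n : ℝ) + 1 + l)) / ((n : ℝ) + 2)) * Polynomial.X *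
          gegenbauer l (n + 1) -
        Polynomial.C (((n : ℝ) + 2 * l) / ((n : ℝ) + 2)) * gegenbauer l n

open MeasureTheory Set Polynomial

section BinomialSeries

theorem Ring.multichoose_succ_mul (a : ℝ) (k : ℕ) :
    (k + 1 : ℝ) * Ring.multichoose a (k + 1) = (a + k) * Ring.multichoose a k := by
  have h0 := Ring.factorial_nsmul_multichoose_eq_ascPochhammer a k
  have h1 := Ring.factorial_nsmul_multichoose_eq_ascPochhammer a (k + 1)
  rw [Polynomial.ascPochhammer_smeval_eq_eval, nsmul_eq_mul] at h0 h1
  rw [ascPochhammer_succ_eval, ← h0, Nat.factorial_succ] at h1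
  push_cast at h1
  have hk : (k.factorial : ℝ) ≠ 0 := by positivity
  apply mul_left_cancel₀ hk
  linear_combination h1

theorem Ring.multichoose_nonneg {a : ℝ} (ha : 0 ≤ a) (k : ℕ) : 0 ≤ Ring.multichoose a k := by
  induction k with
  | zero => simp
  | succ k ih =>
    refine nonneg_of_mul_nonneg_right (a := (k + 1 : ℝ)) ?_ (by positivity)
    rw [Ring.multichoose_succ_mul]
    positivity

theorem Ring.multichoose_neg_lt_zero {δ : ℝ} (h0 : 0 < δ) (h1 : δ < 1) (k : ℕ) :
    Ring.multichoose (-δ) (k + 1) < 0 := by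
  induction k with
  | zero => simpa using h0
  | succ k ih =>
    have h := Ring.multichoose_succ_mul (-δ) (k + 1)
    push_cast at h
    have hk : (0 : ℝ) ≤ k := k.cast_nonneg
    by_contra! hc
    nlinarith [mul_nonneg (by positivity : (0 : ℝ) ≤ k + 1 + 1) hc,
      mul_neg_of_pos_of_neg (by linarith : (0 : ℝ) < -δ + (k + 1)) ih]

theorem hasSum_multichoose_mul_pow (a : ℝ) {x : ℝ} (hx : |x| < 1) :
    HasSum (fun k ↦ Ring.multichoose a k * x ^ k) ((1 - x) ^ (-a)) := by
  have h := (Real.one_div_one_sub_rpow_hasFPowerSeriesOnBall_zero a).hasSum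
    (y := x) (by simpa [Metric.mem_eball, edist_dist, ENNReal.ofReal_lt_one] using hx)
  have h1 : 0 ≤ 1 - x := by linarith [le_abs_self x]
  simpa [Ring.multichoose_eq, FormalMultilinearSeries.ofScalars, Real.rpow_neg h1, mul_comm]
    using h

/-- The power series of `arcsin` has nonnegative coefficients. -/
theorem hasSum_arcsin {t : ℝ} (ht : |t| < 1) :
    HasSum (fun k : ℕ ↦ Ring.multichoose (1 / 2 : ℝ) k / (2 * k + 1) * t ^ (2 * k + 1))
      (Real.arcsin t) := by
  have hsub : ∀ x ∈ uIcc 0 t, |x| ≤ |t| := fun x hx ↦ by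
    simpa using abs_sub_left_of_mem_uIcc hx
  have hsq : ∀ x ∈ uIcc 0 t, |x ^ 2| < 1 := fun x hx ↦ by
    rw [abs_pow, sq_lt_one_iff_abs_lt_one, abs_abs]
    exact (hsub x hx).trans_lt ht
  have hderiv : ∀ x ∈ uIcc 0 t, HasDerivAt Real.arcsin (1 / √(1 - x ^ 2)) x := fun x hx ↦ by
    have := (hsub x hx).trans_lt ht
    rw [abs_lt] at this
    exact Real.hasDerivAt_arcsin this.1.ne' this.2.ne
  have hcont : ContinuousOn (fun x : ℝ ↦ 1 / √(1 - x ^ 2)) (uIcc 0 t) := by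
    refine ContinuousOn.div (by fun_prop) (by fun_prop) fun x hx ↦ ?_
    have := (abs_lt.1 (hsq x hx)).2
    exact (Real.sqrt_pos.2 (by linarith)).ne'
  have hint := intervalIntegral.integral_eq_sub_of_hasDerivAt hderiv hcont.intervalIntegrable
  have hsum := intervalIntegral.hasSum_integral_of_dominated_convergence (μ := volume)
    (a := 0) (b := t)
    (F := fun (k : ℕ) (x : ℝ) ↦ Ring.multichoose (1 / 2 : ℝ) k * (x ^ 2) ^ k)
    (f := fun x ↦ 1 / √(1 - x ^ 2))
    (fun k _ ↦ Ring.multichoose (1 / 2 : ℝ) k * (t ^ 2) ^ k)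
    (fun k ↦ by fun_prop)
    (fun k ↦ .of_forall fun x hx ↦ by
      rw [Real.norm_eq_abs, abs_of_nonneg
        (mul_nonneg (Ring.multichoose_nonneg (by norm_num) k) (by positivity))]
      exact mul_le_mul_of_nonneg_left
        (pow_le_pow_left₀ (sq_nonneg x) (sq_le_sq.2 (hsub x (uIoc_subset_uIcc hx))) k)
        (Ring.multichoose_nonneg (by norm_num) k))
    (.of_forall fun _ _ ↦ (hasSum_multichoose_mul_pow _ (hsq t right_mem_uIcc)).summable)
    intervalIntegrable_const
    (.of_forall fun x hx ↦ by
      have h := hsq x (uIoc_subset_uIcc hx)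
      have h1 : 0 ≤ 1 - x ^ 2 := by linarith [le_abs_self (x ^ 2)]
      have hs := hasSum_multichoose_mul_pow (1 / 2) h
      rwa [Real.rpow_neg h1, ← Real.sqrt_eq_rpow, ← one_div] at hs)
  rw [hint, Real.arcsin_zero, sub_zero] at hsum
  refine hsum.congr_fun fun k ↦ ?_
  simp only [← pow_mul, intervalIntegral.integral_const_mul, integral_pow]
  push_cast
  simp
  ring

end BinomialSeries

section Measure

/-- The measure `(1 - t ^ 2) ^ (l - 1 / 2) dt` on `(-1, 1)`. -/
noncomputable def gegenbauerMeasure (l : ℝ) : Measure ℝ :=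
  (volume.restrict (Ioo (-1) 1)).withDensity fun t ↦ ENNReal.ofReal ((1 - t ^ 2) ^ (l - 1 / 2))

variable {l : ℝ}

theorem integrableOn_one_sub_sq_rpow {a : ℝ} (ha : -1 < a) :
    IntegrableOn (fun t : ℝ ↦ (1 - t ^ 2) ^ a) (Ioo (-1) 1) := by
  have hm : Measurable fun t : ℝ ↦ (1 - t ^ 2) ^ a := by fun_prop
  have h1 : IntegrableOn (fun t : ℝ ↦ (1 - t) ^ a) (Ioo (-1) 1) := by
    have := (intervalIntegral.intervalIntegrable_rpow' (a := 0) (b := 2) ha).comp_sub_left 1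
    rw [sub_zero, show (1 - 2 : ℝ) = -1 by norm_num] at this
    exact ((intervalIntegrable_iff_integrableOn_Ioo_of_le (by norm_num)).1 this.symm)
  have h2 : IntegrableOn (fun t : ℝ ↦ (1 + t) ^ a) (Ioo (-1) 1) := by
    have := (intervalIntegral.intervalIntegrable_rpow' (a := 0) (b := 2) ha).comp_add_left 1
    rw [zero_sub, show (2 - 1 : ℝ) = 1 by norm_num] at this
    exact ((intervalIntegrable_iff_integrableOn_Ioo_of_le (by norm_num)).1 this)
  refine Integrable.mono' ((h1.add h2).add (integrable_const 1)) hm.aestronglyMeasurable ?_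
  filter_upwards [ae_restrict_mem measurableSet_Ioo] with t ht
  have p1 : 0 < 1 - t := by linarith [ht.2]
  have p2 : 0 < 1 + t := by linarith [ht.1]
  have q1 := Real.rpow_pos_of_pos p1 a
  have q2 := Real.rpow_pos_of_pos p2 a
  have e : 1 - t ^ 2 = (1 - t) * (1 + t) := by ring
  have p : 0 < 1 - t ^ 2 := e ▸ mul_pos p1 p2
  rw [Real.norm_eq_abs, abs_of_pos (Real.rpow_pos_of_pos p a)]
  simp only [Pi.add_apply]
  rcases le_or_gt 0 a with h | h
  · have := Real.rpow_le_one p.le (by nlinarith) h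
    linarith
  · rw [e, Real.mul_rpow p1.le p2.le]
    rcases le_total 0 t with h0 | h0
    · have := Real.rpow_le_one_of_one_le_of_nonpos (by linarith : 1 ≤ 1 + t) h.le
      nlinarith
    · have := Real.rpow_le_one_of_one_le_of_nonpos (by linarith : 1 ≤ 1 - t) h.le
      nlinarith

theorem ae_gegenbauerMeasure {p : ℝ → Prop} (h : ∀ t ∈ Ioo (-1 : ℝ) 1, p t) :
    ∀ᵐ t ∂gegenbauerMeasure l, p t :=
  (withDensity_absolutelyContinuous _ _).ae_le
    ((ae_restrict_mem measurableSet_Ioo).mono h)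

theorem isFiniteMeasure_gegenbauerMeasure (hl : 0 < l) :
    IsFiniteMeasure (gegenbauerMeasure l) :=
  isFiniteMeasure_withDensity_ofReal
    (integrableOn_one_sub_sq_rpow (a := l - 1 / 2) (by linarith)).2

theorem integral_gegenbauerMeasure (g : ℝ → ℝ) :
    ∫ t, g t ∂gegenbauerMeasure l = ∫ t in (-1 : ℝ)..1, g t * (1 - t ^ 2) ^ (l - 1 / 2) := by
  rw [gegenbauerMeasure, integral_withDensity_eq_integral_toReal_smul (by fun_prop) (by simp),
    intervalIntegral.integral_of_le (by norm_num), integral_Ioc_eq_integral_Ioo]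
  refine setIntegral_congr_fun measurableSet_Ioo fun t ht ↦ ?_
  have p : 0 ≤ 1 - t ^ 2 := by nlinarith [ht.1, ht.2]
  simp only [smul_eq_mul]
  rw [ENNReal.toReal_ofReal (Real.rpow_nonneg p _), mul_comm]

theorem Continuous.integrable_gegenbauerMeasure (hl : 0 < l) {g : ℝ → ℝ} (hg : Continuous g) :
    Integrable g (gegenbauerMeasure l) := by
  have := isFiniteMeasure_gegenbauerMeasure hl
  obtain ⟨M, hM⟩ := (isCompact_Icc (a := (-1 : ℝ)) (b := 1)).exists_bound_of_continuousOn
    hg.continuousOn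
  exact Integrable.of_bound hg.aestronglyMeasurable M
    (ae_gegenbauerMeasure fun t ht ↦ hM t (Ioo_subset_Icc_self ht))

theorem hasSum_integral_gegenbauerMeasure (hl : 0 < l) {F : ℕ → ℝ → ℝ} {G H p : ℝ → ℝ}
    (hF : ∀ k, Continuous (F k)) (hH : Continuous H) (hp : Continuous p)
    (hFG : ∀ t ∈ Ioo (-1 : ℝ) 1, HasSum (fun k ↦ F k t) (G t))
    (hFH : ∀ t ∈ Ioo (-1 : ℝ) 1, HasSum (fun k ↦ |F k t|) (H t)) :
    HasSum (fun k ↦ ∫ t, F k t * p t ∂gegenbauerMeasure l)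
      (∫ t, G t * p t ∂gegenbauerMeasure l) := by
  refine hasSum_integral_of_dominated_convergence (fun k t ↦ |F k t| * |p t|)
    (fun k ↦ ((hF k).mul hp).aestronglyMeasurable)
    (fun k ↦ .of_forall fun t ↦ by simp)
    (ae_gegenbauerMeasure fun t ht ↦ ((hFH t ht).mul_right _).summable) ?_
    (ae_gegenbauerMeasure fun t ht ↦ (hFG t ht).mul_right _)
  refine ((hH.mul hp.abs).integrable_gegenbauerMeasure hl).congr
    (ae_gegenbauerMeasure fun t ht ↦ ?_)
  exact ((hFH t ht).mul_right _).tsum_eq.symm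

theorem integral_gegenbauerMeasure_deriv (hl : 0 < l) (q : ℝ[X]) :
    ∫ t, ((1 - t ^ 2) * q.derivative.eval t - (2 * l + 1) * t * q.eval t)
      ∂gegenbauerMeasure l = 0 := by
  rw [integral_gegenbauerMeasure]
  have hint : IntervalIntegrable (fun t ↦ ((1 - t ^ 2) * q.derivative.eval t -
      (2 * l + 1) * t * q.eval t) * (1 - t ^ 2) ^ (l - 1 / 2)) volume (-1) 1 := by
    have : IntervalIntegrable (fun t : ℝ ↦ (1 - t ^ 2) ^ (l - 1 / 2)) volume (-1) 1 :=
      (intervalIntegrable_iff_integrableOn_Ioo_of_le (by norm_num)).2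
        (integrableOn_one_sub_sq_rpow (by linarith))
    exact this.continuousOn_mul (by fun_prop)
  rw [intervalIntegral.integral_eq_sub_of_hasDerivAt_of_le
    (f := fun t ↦ (1 - t ^ 2) ^ (l + 1 / 2) * q.eval t) (by norm_num) _ _ hint]
  · have : l + 1 / 2 ≠ 0 := by positivity
    norm_num [Real.zero_rpow, this]
  · have : 0 ≤ l + 1 / 2 := by positivity
    exact (Continuous.mul (Continuous.rpow_const (by fun_prop) fun _ ↦ .inr this)
      (by fun_prop)).continuousOn
  · intro t ht
    have p : 0 < 1 - t ^ 2 := by nlinarith [ht.1, ht.2]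
    have h1 : HasDerivAt (fun t : ℝ ↦ 1 - t ^ 2) (-(2 * t)) t := by
      simpa using ((hasDerivAt_id t).pow 2).const_sub 1
    convert! (h1.rpow_const (p := l + 1 / 2) (.inl p.ne')).mul (q.hasDerivAt t) using 1
    rw [show l + 1 / 2 - 1 = l - 1 / 2 by ring, show l + 1 / 2 = (l - 1 / 2) + 1 by ring,
      Real.rpow_add_one p.ne']
    ring

end Measure

section Gegenbauer

variable {l : ℝ}

theorem eval_gegenbauer_add_two (l : ℝ) (n : ℕ) (t : ℝ) :
    (n + 2) * (gegenbauer l (n + 2)).eval t =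
      2 * (n + 1 + l) * t * (gegenbauer l (n + 1)).eval t -
        (n + 2 * l) * (gegenbauer l n).eval t := by
  have : (n : ℝ) + 2 ≠ 0 := by positivity
  simp only [gegenbauer, eval_sub, eval_mul, eval_C, eval_X]
  field_simp

theorem eval_derivative_gegenbauer_add_two (l : ℝ) (n : ℕ) (t : ℝ) :
    (n + 2) * (gegenbauer l (n + 2)).derivative.eval t =
      2 * (n + 1 + l) * ((gegenbauer l (n + 1)).eval t +
        t * (gegenbauer l (n + 1)).derivative.eval t) -
        (n + 2 * l) * (gegenbauer l n).derivative.eval t := by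
  have : (n : ℝ) + 2 ≠ 0 := by positivity
  simp only [gegenbauer, derivative_sub, derivative_mul, derivative_C, derivative_X, eval_sub,
    eval_add, eval_mul, eval_C, eval_X, eval_zero, eval_one]
  field_simp
  ring

theorem one_sub_sq_mul_eval_derivative_gegenbauer (l : ℝ) (t : ℝ) (n : ℕ) :
    (1 - t ^ 2) * (gegenbauer l n).derivative.eval t =
      (n + 2 * l) * t * (gegenbauer l n).eval t - (n + 1) * (gegenbauer l (n + 1)).eval t := by
  induction n using Nat.twoStepInduction with
  | zero => simp [gegenbauer]
  | one =>
    have h := eval_gegenbauer_add_two l 0 t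
    simp [gegenbauer] at h ⊢
    ring
  | more n h0 h1 =>
    have e2 := eval_gegenbauer_add_two l n t
    have e3 := eval_gegenbauer_add_two l (n + 1) t
    have d2 := eval_derivative_gegenbauer_add_two l n t
    have hn : (n : ℝ) + 2 ≠ 0 := by positivity
    push_cast at *
    apply mul_left_cancel₀ hn
    linear_combination (1 - t ^ 2) * d2 + 2 * (n + 1 + l) * t * h1 - (n + 2 * l) * h0 +
      (n + 2) * e3 - (n + 2 * l) * t * e2

/-- The unnormalized Gegenbauer coefficient of order `n` of `g`. -/
noncomputable def gegenbauerCoeff (l : ℝ) (n : ℕ) (g : ℝ → ℝ) : ℝ :=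
  ∫ t, g t * (gegenbauer l n).eval t ∂gegenbauerMeasure l

theorem gegenbauerCoeff_zero_mul_id (l : ℝ) (g : ℝ → ℝ) :
    2 * l * gegenbauerCoeff l 0 (fun t ↦ t * g t) = gegenbauerCoeff l 1 g := by
  rw [gegenbauerCoeff, gegenbauerCoeff, ← integral_const_mul]
  congr 1 with t
  simp [gegenbauer]
  ring

theorem gegenbauerCoeff_succ_mul_id (hl : 0 < l) (n : ℕ) {g : ℝ → ℝ} (hg : Continuous g) :
    2 * (n + 1 + l) * gegenbauerCoeff l (n + 1) (fun t ↦ t * g t) =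
      (n + 2) * gegenbauerCoeff l (n + 2) g + (n + 2 * l) * gegenbauerCoeff l n g := by
  simp only [gegenbauerCoeff, ← integral_const_mul]
  rw [← integral_add]
  · congr 1 with t
    linear_combination -g t * eval_gegenbauer_add_two l n t
  all_goals
    exact Continuous.integrable_gegenbauerMeasure hl (by fun_prop)

theorem gegenbauerCoeff_succ_one (hl : 0 < l) (n : ℕ) :
    gegenbauerCoeff l (n + 1) (fun _ ↦ 1) = 0 := by
  have key (n : ℕ) : (n - 1) * gegenbauerCoeff l n (fun t ↦ t * 1) =
      (n + 1) * gegenbauerCoeff l (n + 1) (fun _ ↦ 1) := by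
    rw [← sub_eq_zero]
    simp only [gegenbauerCoeff, ← integral_const_mul]
    rw [← integral_sub, ← integral_gegenbauerMeasure_deriv hl (gegenbauer l n)]
    · congr 1 with t
      linear_combination -one_sub_sq_mul_eval_derivative_gegenbauer l t n
    all_goals
      exact Continuous.integrable_gegenbauerMeasure hl (by fun_prop)
  induction n using Nat.twoStepInduction with
  | zero =>
    have h := key 0
    have h' := gegenbauerCoeff_zero_mul_id l fun _ ↦ 1
    simp only [Nat.cast_zero, zero_add, one_mul] at h ⊢
    nlinarith
  | one =>
    have h := key 1
    norm_num at h
    exact h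
  | more n h0 _ =>
    have h := key (n + 2)
    have h' := gegenbauerCoeff_succ_mul_id hl (n + 1) (continuous_const (y := (1 : ℝ)))
    rw [h0, mul_zero, add_zero] at h'
    push_cast at h h'
    have hx : (2 * (n + 2 + l) - (n + 1)) * gegenbauerCoeff l (n + 2) (fun t ↦ t * 1) = 0 := by
      linear_combination h' - h
    have hx' := (mul_eq_zero.1 hx).resolve_left (by nlinarith [n.cast_nonneg (α := ℝ)])
    rw [hx', mul_zero] at h
    exact (mul_eq_zero.1 h.symm).resolve_left (by positivity)

theorem gegenbauerCoeff_zero_one_pos (hl : 0 < l) : 0 < gegenbauerCoeff l 0 (fun _ ↦ 1) := by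
  have hint : IntervalIntegrable (fun t : ℝ ↦ (1 - t ^ 2) ^ (l - 1 / 2)) volume (-1) 1 :=
    (intervalIntegrable_iff_integrableOn_Ioo_of_le (by norm_num)).2
      (integrableOn_one_sub_sq_rpow (by linarith))
  rw [gegenbauerCoeff, integral_gegenbauerMeasure]
  simp only [gegenbauer, eval_one, one_mul]
  refine intervalIntegral.intervalIntegral_pos_of_pos_on hint (fun t ht ↦ ?_) (by norm_num)
  exact Real.rpow_pos_of_pos (by nlinarith [ht.1, ht.2]) _

theorem gegenbauerCoeff_mul_id_nonneg (hl : 0 < l) {g : ℝ → ℝ} (hg : Continuous g)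
    (h : ∀ n, 0 ≤ gegenbauerCoeff l n g) (n : ℕ) :
    0 ≤ gegenbauerCoeff l n (fun t ↦ t * g t) := by
  cases n with
  | zero =>
    refine nonneg_of_mul_nonneg_right (a := 2 * l) ?_ (by positivity)
    rw [gegenbauerCoeff_zero_mul_id l]
    exact h 1
  | succ n =>
    refine nonneg_of_mul_nonneg_right (a := 2 * (n + 1 + l)) ?_ (by positivity)
    rw [gegenbauerCoeff_succ_mul_id hl n hg]
    have := h n
    have := h (n + 2)
    positivity

theorem gegenbauerCoeff_pow_mul_nonneg (hl : 0 < l) {g : ℝ → ℝ} (hg : Continuous g)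
    (h : ∀ n, 0 ≤ gegenbauerCoeff l n g) (j n : ℕ) :
    0 ≤ gegenbauerCoeff l n (fun t ↦ t ^ j * g t) := by
  induction j generalizing n with
  | zero => simpa using h n
  | succ j ih =>
    simpa only [pow_succ', mul_assoc] using
      gegenbauerCoeff_mul_id_nonneg hl (g := fun t ↦ t ^ j * g t) (by fun_prop) ih n

theorem hasSum_gegenbauerCoeff_arcsin_mul (hl : 0 < l) {g : ℝ → ℝ} (hg : Continuous g) (n : ℕ) :
    HasSum (fun k : ℕ ↦ Ring.multichoose (1 / 2 : ℝ) k / (2 * k + 1) *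
        gegenbauerCoeff l n (fun t ↦ t ^ (2 * k + 1) * g t))
      (gegenbauerCoeff l n (fun t ↦ Real.arcsin t * g t)) := by
  have h := hasSum_integral_gegenbauerMeasure hl
    (F := fun k t ↦ Ring.multichoose (1 / 2 : ℝ) k / (2 * k + 1) * t ^ (2 * k + 1))
    (G := Real.arcsin) (H := fun t ↦ Real.arcsin |t|)
    (p := fun t ↦ g t * (gegenbauer l n).eval t)
    (fun k ↦ by fun_prop) (Real.continuous_arcsin.comp continuous_abs) (by fun_prop)
    (fun t ht ↦ hasSum_arcsin (abs_lt.2 ht))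
    (fun t ht ↦ by
      convert hasSum_arcsin (t := |t|) (by rw [abs_abs]; exact abs_lt.2 ht) using 2 with k
      rw [abs_mul, abs_pow, abs_of_nonneg
        (div_nonneg (Ring.multichoose_nonneg (by norm_num) k) (by positivity))])
  simpa only [gegenbauerCoeff, ← integral_const_mul, mul_assoc] using h

theorem gegenbauerCoeff_mul_id_le_arcsin_mul (hl : 0 < l) {g : ℝ → ℝ} (hg : Continuous g)
    (h : ∀ n, 0 ≤ gegenbauerCoeff l n g) (n : ℕ) :
    gegenbauerCoeff l n (fun t ↦ t * g t) ≤
      gegenbauerCoeff l n (fun t ↦ Real.arcsin t * g t) := by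
  have := le_hasSum (hasSum_gegenbauerCoeff_arcsin_mul hl hg n) 0 fun k _ ↦
    mul_nonneg (div_nonneg (Ring.multichoose_nonneg (by norm_num) k) (by positivity))
      (gegenbauerCoeff_pow_mul_nonneg hl hg h _ n)
  simpa using this

theorem gegenbauerCoeff_arcsin_pow_nonneg (hl : 0 < l) (k n : ℕ) :
    0 ≤ gegenbauerCoeff l n (fun t ↦ Real.arcsin t ^ k) := by
  induction k generalizing n with
  | zero =>
    simp only [pow_zero]
    cases n with
    | zero => exact (gegenbauerCoeff_zero_one_pos hl).le
    | succ n => exact (gegenbauerCoeff_succ_one hl n).ge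
  | succ k ih =>
    have hc : Continuous fun t ↦ Real.arcsin t ^ k := Real.continuous_arcsin.pow k
    simpa only [pow_succ'] using (gegenbauerCoeff_mul_id_nonneg hl hc ih n).trans
      (gegenbauerCoeff_mul_id_le_arcsin_mul hl hc ih n)

theorem gegenbauerCoeff_arcsin_pow_self_pos (hl : 0 < l) (n : ℕ) :
    0 < gegenbauerCoeff l n (fun t ↦ Real.arcsin t ^ n) := by
  induction n with
  | zero => simpa using gegenbauerCoeff_zero_one_pos hl
  | succ n ih =>
    have hc : Continuous fun t ↦ Real.arcsin t ^ n := Real.continuous_arcsin.pow n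
    have h := gegenbauerCoeff_arcsin_pow_nonneg hl n
    refine lt_of_lt_of_le ?_ (by
      simpa only [pow_succ'] using gegenbauerCoeff_mul_id_le_arcsin_mul hl hc h (n + 1))
    refine pos_of_mul_pos_right (a := 2 * (n + 1 + l)) ?_ (by positivity)
    rw [gegenbauerCoeff_succ_mul_id hl n hc]
    have := h (n + 2)
    positivity

end Gegenbauer

/-- For `λ > 0`, `0 < δ < 1`, and every integer `n ≥ 1`,
`∫_{-1}^1 (arccos t)^δ C_n^λ(t) (1-t^2)^(λ-1/2) dt < 0`. -/
theorem gegenbauer_coeff_arccos_pow_neg (l δ : ℝ) (hl : 0 < l) (hδ0 : 0 < δ) (hδ1 : δ < 1)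
    (n : ℕ) (hn : 1 ≤ n) :
    (∫ t in (-1:ℝ)..1,
        (Real.arccos t) ^ δ * (gegenbauer l n).eval t * (1 - t^2) ^ (l - 1/2)) < 0 := by
  set v : ℝ → ℝ := fun t ↦ 2 / Real.pi * Real.arcsin t with hv
  have hvc : Continuous v := Real.continuous_arcsin.const_mul _
  have hπ := Real.pi_pos
  have hvlt (t : ℝ) (ht : t ∈ Ioo (-1 : ℝ) 1) : |v t| < 1 := by
    have h1 := Real.neg_pi_div_two_lt_arcsin.2 ht.1
    have h2 := Real.arcsin_lt_pi_div_two.2 ht.2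
    have h : |Real.arcsin t| < Real.pi / 2 := abs_lt.2 ⟨by linarith, h2⟩
    rw [hv, abs_mul, abs_of_pos (by positivity)]
    calc 2 / Real.pi * |Real.arcsin t| < 2 / Real.pi * (Real.pi / 2) := by gcongr
      _ = 1 := by field_simp
  have hrpow (a : ℝ → ℝ) (ha : Continuous a) : Continuous fun t ↦ a t ^ δ :=
    ha.rpow_const fun _ ↦ .inr hδ0.le
  have hsum (x : ℝ) (hx : |x| < 1) :
      HasSum (fun k ↦ Ring.multichoose (-δ) k * x ^ k) ((1 - x) ^ δ) := by
    simpa using hasSum_multichoose_mul_pow (-δ) hx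
  have hcoeff := hasSum_integral_gegenbauerMeasure hl
    (F := fun k t ↦ Ring.multichoose (-δ) k * v t ^ k) (G := fun t ↦ (1 - v t) ^ δ)
    (H := fun t ↦ 2 - (1 - |v t|) ^ δ) (p := fun t ↦ (gegenbauer l n).eval t)
    (fun k ↦ by fun_prop) (continuous_const.sub (hrpow _ (by fun_prop))) (by fun_prop)
    (fun t ht ↦ hsum _ (hvlt t ht))
    (fun t ht ↦ by
      have h0 : HasSum (fun k : ℕ ↦ if k = 0 then (2 : ℝ) else 0) 2 := hasSum_ite_eq 0 2
      refine (h0.sub (hsum |v t| (by rw [abs_abs]; exact hvlt t ht))).congr_fun fun k ↦ ?_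
      cases k with
      | zero => norm_num
      | succ k => simp [abs_mul, abs_of_neg (Ring.multichoose_neg_lt_zero hδ0 hδ1 k)])
  have hterm (k : ℕ) : ∫ t, Ring.multichoose (-δ) k * v t ^ k * (gegenbauer l n).eval t
      ∂gegenbauerMeasure l = Ring.multichoose (-δ) k * (2 / Real.pi) ^ k *
        gegenbauerCoeff l n (fun t ↦ Real.arcsin t ^ k) := by
    rw [gegenbauerCoeff, ← integral_const_mul]
    congr 1 with t
    rw [hv]
    ring
  simp only [hterm] at hcoeff
  obtain ⟨m, rfl⟩ : ∃ m, n = m + 1 := ⟨n - 1, by omega⟩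
  have hneg := hasSum_lt (i := m + 1) (fun k ↦ ?_) ?_ hcoeff hasSum_zero
  · rw [← integral_gegenbauerMeasure
      fun t ↦ Real.arccos t ^ δ * (gegenbauer l (m + 1)).eval t]
    have : ∫ t, Real.arccos t ^ δ * (gegenbauer l (m + 1)).eval t ∂gegenbauerMeasure l =
        (Real.pi / 2) ^ δ *
          ∫ t, (1 - v t) ^ δ * (gegenbauer l (m + 1)).eval t ∂gegenbauerMeasure l := by
      rw [← integral_const_mul]
      refine integral_congr_ae (ae_gegenbauerMeasure fun t ht ↦ ?_)
      have h1 : 0 ≤ 1 - v t := by linarith [(abs_lt.1 (hvlt t ht)).2]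
      have h2 : Real.arccos t = Real.pi / 2 * (1 - v t) := by
        rw [Real.arccos, hv]
        field_simp
      simp only [h2]
      rw [Real.mul_rpow (by positivity) h1, mul_assoc]
    rw [this]
    exact mul_neg_of_pos_of_neg (by positivity) hneg
  · cases k with
    | zero => simp [gegenbauerCoeff_succ_one hl m]
    | succ k =>
      exact mul_nonpos_of_nonpos_of_nonneg
        (mul_nonpos_of_nonpos_of_nonneg (Ring.multichoose_neg_lt_zero hδ0 hδ1 k).le (by positivity))
        (gegenbauerCoeff_arcsin_pow_nonneg hl _ _)
  · exact mul_neg_of_neg_of_pos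
      (mul_neg_of_neg_of_pos (Ring.multichoose_neg_lt_zero hδ0 hδ1 m) (by positivity))
      (gegenbauerCoeff_arcsin_pow_self_pos hl _)
end

section
/- Let λ > 0 and 0 < δ < 1. Then there exist constants 0 < c ≤ C such that for all n ≥ 1, c n^{-2λ-1-δ} ≤ −∫_0^π θ^δ (C_n^λ(cos θ)/C_n^λ(1)) (sin θ)^{2λ} dθ ≤ C n^{-2λ-1-δ}. -/
open MeasureTheory Set Polynomial

theorem gegenbauer_eval_one_succ (l : ℝ) (n : ℕ) :
    ((n : ℝ) + 1) * (gegenbauer l (n + 1)).eval 1 =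
      ((n : ℝ) + 2 * l) * (gegenbauer l n).eval 1 := by
  induction n with
  | zero => simp [gegenbauer]
  | succ n ih =>
    have h2 : (n : ℝ) + 2 ≠ 0 := by positivity
    simp only [gegenbauer, eval_sub, eval_mul, eval_C, eval_X]
    push_cast
    field_simp
    linear_combination ((n : ℝ) + 2) * ih

theorem gegenbauer_eval_one_pos {l : ℝ} (hl : 0 < l) (n : ℕ) :
    0 < (gegenbauer l n).eval 1 := by
  induction n with
  | zero => simp [gegenbauer]
  | succ n ih =>
    have h := gegenbauer_eval_one_succ l n
    have h1 : 0 < ((n : ℝ) + 2 * l) * (gegenbauer l n).eval 1 := by positivity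
    rw [← h] at h1
    exact pos_of_mul_pos_right h1 (by positivity)

/-- The Gegenbauer polynomial normalized to take the value `1` at `1`. -/
noncomputable def normalizedGegenbauer (l : ℝ) (n : ℕ) : ℝ[X] :=
  C ((gegenbauer l n).eval 1)⁻¹ * gegenbauer l n

theorem normalizedGegenbauer_zero (l : ℝ) : normalizedGegenbauer l 0 = 1 := by
  simp [normalizedGegenbauer, gegenbauer]

theorem normalizedGegenbauer_one {l : ℝ} (hl : 0 < l) : normalizedGegenbauer l 1 = X := by
  simp only [normalizedGegenbauer, gegenbauer, eval_mul, eval_C, eval_X, mul_one, ← mul_assoc,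
    ← C_mul]
  rw [mul_assoc, inv_mul_cancel₀ (by positivity)]
  simp

theorem normalizedGegenbauer_recurrence {l : ℝ} (hl : 0 < l) (n : ℕ) :
    C ((n : ℝ) + 1 + 2 * l) * normalizedGegenbauer l (n + 2) =
      C (2 * ((n : ℝ) + 1 + l)) * X * normalizedGegenbauer l (n + 1) -
        C ((n : ℝ) + 1) * normalizedGegenbauer l n := by
  have h0 := gegenbauer_eval_one_pos hl n
  have h1 := gegenbauer_eval_one_succ l n
  have h2 := gegenbauer_eval_one_succ l (n + 1)
  have h3 := gegenbauer_eval_one_pos hl (n + 1)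
  have h4 := gegenbauer_eval_one_pos hl (n + 2)
  push_cast at h2
  set a := (gegenbauer l n).eval 1
  set b := (gegenbauer l (n + 1)).eval 1
  set c := (gegenbauer l (n + 2)).eval 1
  have e : gegenbauer l (n + 2) = C ((2 * ((n : ℝ) + 1 + l)) / ((n : ℝ) + 2)) * X *
          gegenbauer l (n + 1) -
        C (((n : ℝ) + 2 * l) / ((n : ℝ) + 2)) * gegenbauer l n := by
    rw [gegenbauer]
  have hn : 0 < (n : ℝ) + 2 := by positivity
  have hn1 : 0 < (n : ℝ) + 1 := by positivity
  have hn2 : 0 < (n : ℝ) + 2 * l := by positivity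
  have e1 : ((n : ℝ) + 1 + 2 * l) * c⁻¹ * ((2 * ((n : ℝ) + 1 + l)) / ((n : ℝ) + 2)) =
      (2 * ((n : ℝ) + 1 + l)) * b⁻¹ := by
    field_simp
    linear_combination -h2
  have e2 : ((n : ℝ) + 1 + 2 * l) * c⁻¹ * (((n : ℝ) + 2 * l) / ((n : ℝ) + 2)) =
      ((n : ℝ) + 1) * a⁻¹ := by
    field_simp
    linear_combination (-((n : ℝ) + 1)) * h2 - ((n : ℝ) + 1 + 2 * l) * h1
  have e1' := congrArg (C : ℝ → ℝ[X]) e1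
  have e2' := congrArg (C : ℝ → ℝ[X]) e2
  simp only [C_mul] at e1' e2'
  simp only [normalizedGegenbauer]
  simp only [C_mul]
  linear_combination (C ((n : ℝ) + 1 + 2 * l) * C c⁻¹) * e +
    (X * gegenbauer l (n + 1)) * e1' - gegenbauer l n * e2'

theorem normalizedGegenbauer_eval_recurrence {l : ℝ} (hl : 0 < l) (n : ℕ) (x : ℝ) :
    ((n : ℝ) + 1 + 2 * l) * (normalizedGegenbauer l (n + 2)).eval x =
      2 * ((n : ℝ) + 1 + l) * x * (normalizedGegenbauer l (n + 1)).eval x -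
        ((n : ℝ) + 1) * (normalizedGegenbauer l n).eval x := by
  simpa only [eval_sub, eval_mul, eval_C, eval_X] using
    congrArg (eval x) (normalizedGegenbauer_recurrence hl n)

theorem normalizedGegenbauer_derivative_recurrence {l : ℝ} (hl : 0 < l) (n : ℕ) (x : ℝ) :
    ((n : ℝ) + 1 + 2 * l) * (derivative (normalizedGegenbauer l (n + 2))).eval x =
      2 * ((n : ℝ) + 1 + l) * ((normalizedGegenbauer l (n + 1)).eval x +
        x * (derivative (normalizedGegenbauer l (n + 1))).eval x) -
        ((n : ℝ) + 1) * (derivative (normalizedGegenbauer l n)).eval x := by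
  have h := congrArg (fun p => eval x (derivative p)) (normalizedGegenbauer_recurrence hl n)
  simp only [derivative_sub, derivative_mul, derivative_C, derivative_X, eval_sub, eval_mul,
    eval_add, eval_C, eval_X, eval_zero, eval_one] at h
  linear_combination h

theorem normalizedGegenbauer_derivative_lower_raise {l : ℝ} (hl : 0 < l) (n : ℕ) (x : ℝ) :
    (1 - x ^ 2) * (derivative (normalizedGegenbauer l n)).eval x =
        ((n : ℝ) + 2 * l) *
          (x * (normalizedGegenbauer l n).eval x - (normalizedGegenbauer l (n + 1)).eval x) ∧
      (1 - x ^ 2) * (derivative (normalizedGegenbauer l (n + 1))).eval x =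
        ((n : ℝ) + 1) *
          ((normalizedGegenbauer l n).eval x - x * (normalizedGegenbauer l (n + 1)).eval x) := by
  induction n with
  | zero => simp [normalizedGegenbauer_zero, normalizedGegenbauer_one hl]; ring
  | succ n ih =>
    obtain ⟨hA, hB⟩ := ih
    have hr := normalizedGegenbauer_eval_recurrence hl n x
    have hd := normalizedGegenbauer_derivative_recurrence hl n x
    push_cast
    refine ⟨by linear_combination hB + hr, ?_⟩
    have hne : (n : ℝ) + 1 + 2 * l ≠ 0 := by positivity
    refine mul_left_cancel₀ hne ?_
    linear_combination (1 - x ^ 2) * hd + 2 * ((n : ℝ) + 1 + l) * x * hB - ((n : ℝ) + 1) * hA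
      + ((n : ℝ) + 2) * x * hr

theorem normalizedGegenbauer_derivative_raise {l : ℝ} (hl : 0 < l) (n : ℕ) (x : ℝ) :
    (1 - x ^ 2) * (derivative (normalizedGegenbauer l n)).eval x =
      ((n : ℝ) + 2 * l) *
        (x * (normalizedGegenbauer l n).eval x - (normalizedGegenbauer l (n + 1)).eval x) :=
  (normalizedGegenbauer_derivative_lower_raise hl n x).1

theorem normalizedGegenbauer_derivative_lower {l : ℝ} (hl : 0 < l) (n : ℕ) (x : ℝ) :
    (1 - x ^ 2) * (derivative (normalizedGegenbauer l (n + 1))).eval x =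
      ((n : ℝ) + 1) *
        ((normalizedGegenbauer l n).eval x - x * (normalizedGegenbauer l (n + 1)).eval x) :=
  (normalizedGegenbauer_derivative_lower_raise hl n x).2

/-- The density `sin^{2l} θ · R_n(cos θ)`. -/
noncomputable def gegenbauerDensity (l : ℝ) (n : ℕ) (θ : ℝ) : ℝ :=
  (normalizedGegenbauer l n).eval (Real.cos θ) * Real.sin θ ^ (2 * l)

theorem continuous_gegenbauerDensity {l : ℝ} (hl : 0 < l) (n : ℕ) :
    Continuous (gegenbauerDensity l n) :=
  ((normalizedGegenbauer l n).continuous.comp Real.continuous_cos).mul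
    (Real.continuous_sin.rpow_const fun _ => Or.inr (by positivity))

theorem hasDerivAt_sin_rpow (a : ℝ) {θ : ℝ} (h : 0 < Real.sin θ) :
    HasDerivAt (fun t => Real.sin t ^ a) (Real.cos θ * a * Real.sin θ ^ (a - 1)) θ :=
  (Real.hasDerivAt_sin θ).rpow_const (Or.inl h.ne')

theorem hasDerivAt_eval_cos (p : ℝ[X]) (θ : ℝ) :
    HasDerivAt (fun t => p.eval (Real.cos t))
      (p.derivative.eval (Real.cos θ) * -Real.sin θ) θ :=
  (p.hasDerivAt (Real.cos θ)).comp θ (Real.hasDerivAt_cos θ)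

/-- The derivative of `gegenbauerDensity l (n + 2) - gegenbauerDensity l n`. -/
noncomputable def densityGapDeriv (l : ℝ) (n : ℕ) (θ : ℝ) : ℝ :=
  Real.sin θ ^ (2 * l + 1) * (-2 * ((n : ℝ) + 1 + l) *
      (normalizedGegenbauer l (n + 1)).eval (Real.cos θ) -
    (1 / ((n : ℝ) + 1) + 1 / ((n : ℝ) + 1 + 2 * l)) * Real.cos θ *
      (derivative (normalizedGegenbauer l (n + 1))).eval (Real.cos θ))

theorem continuous_densityGapDeriv {l : ℝ} (hl : 0 < l) (n : ℕ) :
    Continuous (densityGapDeriv l n) := by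
  have h1 := (normalizedGegenbauer l (n + 1)).continuous.comp Real.continuous_cos
  have h2 := (derivative (normalizedGegenbauer l (n + 1))).continuous.comp Real.continuous_cos
  have h3 : Continuous fun θ => Real.sin θ ^ (2 * l + 1) :=
    Real.continuous_sin.rpow_const fun _ => Or.inr (by positivity)
  exact h3.mul ((continuous_const.mul h1).sub ((continuous_const.mul Real.continuous_cos).mul h2))

theorem densityGapDeriv_eq {l : ℝ} (hl : 0 < l) (n : ℕ) {θ : ℝ} (h : 0 < Real.sin θ) :
    densityGapDeriv l n θ = Real.sin θ ^ (2 * l - 1) *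
      (((n : ℝ) + 2 + 2 * l) * Real.cos θ * (normalizedGegenbauer l (n + 2)).eval (Real.cos θ) -
        2 * ((n : ℝ) + 1 + l) * (normalizedGegenbauer l (n + 1)).eval (Real.cos θ) +
        n * Real.cos θ * (normalizedGegenbauer l n).eval (Real.cos θ)) := by
  have hr := normalizedGegenbauer_eval_recurrence hl n (Real.cos θ)
  have hB := normalizedGegenbauer_derivative_lower hl n (Real.cos θ)
  have e : Real.sin θ ^ (2 * l + 1) = Real.sin θ ^ (2 * l - 1) * (1 - Real.cos θ ^ 2) := by
    rw [← Real.sin_sq, ← Real.rpow_natCast, ← Real.rpow_add h]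
    congr 1; push_cast; ring
  rw [densityGapDeriv, e, mul_assoc]
  congr 1
  have hn1 : (n : ℝ) + 1 ≠ 0 := by positivity
  have hn2 : (n : ℝ) + 1 + 2 * l ≠ 0 := by positivity
  set c := Real.cos θ
  set r0 := (normalizedGegenbauer l n).eval c
  set r1 := (normalizedGegenbauer l (n + 1)).eval c
  set r2 := (normalizedGegenbauer l (n + 2)).eval c
  set d := (derivative (normalizedGegenbauer l (n + 1))).eval c
  have hgap : (1 / ((n : ℝ) + 1) + 1 / ((n : ℝ) + 1 + 2 * l)) * ((1 - c ^ 2) * d) = r0 - r2 := by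
    rw [hB]
    field_simp
    linear_combination hr
  linear_combination (-c) * hgap - c * hr

theorem hasDerivAt_gegenbauerDensity (l : ℝ) (n : ℕ) {θ : ℝ} (h : 0 < Real.sin θ) :
    HasDerivAt (gegenbauerDensity l n) (Real.sin θ ^ (2 * l - 1) *
      (2 * l * Real.cos θ * (normalizedGegenbauer l n).eval (Real.cos θ) -
        (1 - Real.cos θ ^ 2) * (derivative (normalizedGegenbauer l n)).eval (Real.cos θ))) θ := by
  refine ((hasDerivAt_eval_cos (normalizedGegenbauer l n) θ).mul
    (hasDerivAt_sin_rpow (2 * l) h)).congr_deriv ?_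
  have e : Real.sin θ ^ (2 * l) = Real.sin θ ^ (2 * l - 1) * Real.sin θ := by
    rw [← Real.rpow_add_one h.ne']; congr 1; ring
  rw [e, ← Real.sin_sq]
  ring

theorem hasDerivAt_densityGap {l : ℝ} (hl : 0 < l) (n : ℕ) {θ : ℝ} (h : 0 < Real.sin θ) :
    HasDerivAt (fun t => gegenbauerDensity l (n + 2) t - gegenbauerDensity l n t)
      (densityGapDeriv l n θ) θ := by
  refine ((hasDerivAt_gegenbauerDensity l (n + 2) h).sub
    (hasDerivAt_gegenbauerDensity l n h)).congr_deriv ?_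
  rw [densityGapDeriv_eq hl n h, ← mul_sub]
  congr 1
  have h2 := normalizedGegenbauer_derivative_lower hl (n + 1) (Real.cos θ)
  have h0 := normalizedGegenbauer_derivative_raise hl n (Real.cos θ)
  push_cast at h2
  linear_combination h0 - h2

theorem hasDerivAt_densityGapDeriv {l : ℝ} (hl : 0 < l) (n : ℕ) {θ : ℝ} (h : 0 < Real.sin θ) :
    HasDerivAt (densityGapDeriv l n) ((n : ℝ) ^ 2 * gegenbauerDensity l n θ -
      ((n : ℝ) + 2 + 2 * l) ^ 2 * gegenbauerDensity l (n + 2) θ) θ := by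
  have hev : densityGapDeriv l n =ᶠ[nhds θ] fun t => Real.sin t ^ (2 * l - 1) *
      (((n : ℝ) + 2 + 2 * l) * Real.cos t * (normalizedGegenbauer l (n + 2)).eval (Real.cos t) -
        2 * ((n : ℝ) + 1 + l) * (normalizedGegenbauer l (n + 1)).eval (Real.cos t) +
        n * Real.cos t * (normalizedGegenbauer l n).eval (Real.cos t)) := by
    filter_upwards [Real.continuous_sin.continuousAt.eventually (lt_mem_nhds h)] with t ht
    exact densityGapDeriv_eq hl n ht
  refine HasDerivAt.congr_of_eventuallyEq ?_ hev
  have hc := Real.hasDerivAt_cos θ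
  refine ((hasDerivAt_sin_rpow (2 * l - 1) h).mul
    ((((hc.const_mul ((n : ℝ) + 2 + 2 * l)).mul
        (hasDerivAt_eval_cos (normalizedGegenbauer l (n + 2)) θ)).sub
      ((hasDerivAt_eval_cos (normalizedGegenbauer l (n + 1)) θ).const_mul
        (2 * ((n : ℝ) + 1 + l)))).add
      ((hc.const_mul (n : ℝ)).mul
        (hasDerivAt_eval_cos (normalizedGegenbauer l n) θ)))).congr_deriv ?_
  have h2 := normalizedGegenbauer_derivative_lower hl (n + 1) (Real.cos θ)
  have h1 := normalizedGegenbauer_derivative_lower hl n (Real.cos θ)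
  have h0 := normalizedGegenbauer_derivative_raise hl n (Real.cos θ)
  have hr := normalizedGegenbauer_eval_recurrence hl n (Real.cos θ)
  have e1 : Real.sin θ ^ (2 * l - 1) = Real.sin θ ^ (2 * l - 1 - 1) * Real.sin θ := by
    rw [← Real.rpow_add_one h.ne']; congr 1; ring
  have e2 : Real.sin θ ^ (2 * l) = Real.sin θ ^ (2 * l - 1 - 1) * Real.sin θ ^ 2 := by
    rw [← Real.rpow_natCast, ← Real.rpow_add h]; congr 1; push_cast; ring
  have e3 := Real.sin_sq θ
  simp only [gegenbauerDensity, Pi.add_apply, Pi.sub_apply, Pi.mul_apply]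
  rw [e2, e1]
  push_cast at h2
  set c := Real.cos θ
  set s := Real.sin θ
  set r0 := (normalizedGegenbauer l n).eval c
  set r1 := (normalizedGegenbauer l (n + 1)).eval c
  set r2 := (normalizedGegenbauer l (n + 2)).eval c
  set d0 := (derivative (normalizedGegenbauer l n)).eval c
  set d1 := (derivative (normalizedGegenbauer l (n + 1))).eval c
  set d2 := (derivative (normalizedGegenbauer l (n + 2))).eval c
  set S := s ^ (2 * l - 1 - 1)
  have key : (2 * l - 1) * c * (((n : ℝ) + 2 + 2 * l) * c * r2 - 2 * ((n : ℝ) + 1 + l) * r1 +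
      n * c * r0) - (1 - c ^ 2) * (((n : ℝ) + 2 + 2 * l) * (r2 + c * d2) -
        2 * ((n : ℝ) + 1 + l) * d1 + n * (r0 + c * d0)) =
      (1 - c ^ 2) * ((n : ℝ) ^ 2 * r0 - ((n : ℝ) + 2 + 2 * l) ^ 2 * r2) := by
    linear_combination (-((n : ℝ) + 2 + 2 * l) * c) * h2 + 2 * ((n : ℝ) + 1 + l) * h1
      - n * c * h0 + ((n : ℝ) + 2 + 2 * l) * hr
  rw [← e3] at key
  linear_combination S * key

/-- The Laplace transform of `gegenbauerDensity` over `[0, π]`. -/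
noncomputable def gegenbauerLaplace (l : ℝ) (n : ℕ) (s : ℝ) : ℝ :=
  ∫ θ in (0 : ℝ)..Real.pi, Real.exp (-s * θ) * gegenbauerDensity l n θ

/-- The Laplace transform of `sin ^ a` over `[0, π]`. -/
noncomputable def sinLaplace (a s : ℝ) : ℝ :=
  ∫ θ in (0 : ℝ)..Real.pi, Real.exp (-s * θ) * Real.sin θ ^ a

theorem hasDerivAt_exp_neg_mul (s θ : ℝ) :
    HasDerivAt (fun t => Real.exp (-s * t)) (Real.exp (-s * θ) * -s) θ := by
  simpa using ((hasDerivAt_id θ).const_mul (-s)).exp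

theorem continuous_exp_neg_mul (s : ℝ) : Continuous fun t : ℝ => Real.exp (-s * t) := by
  fun_prop

theorem continuous_sin_rpow {a : ℝ} (ha : 0 < a) : Continuous fun t : ℝ => Real.sin t ^ a :=
  Real.continuous_sin.rpow_const fun _ => Or.inr ha.le

theorem intervalIntegrable_exp_neg_mul {f : ℝ → ℝ} (hf : Continuous f) (s a b : ℝ) :
    IntervalIntegrable (fun t => Real.exp (-s * t) * f t) volume a b :=
  ((continuous_exp_neg_mul s).mul hf).intervalIntegrable _ _

theorem gegenbauerLaplace_zero (l s : ℝ) : gegenbauerLaplace l 0 s = sinLaplace (2 * l) s := by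
  simp [gegenbauerLaplace, sinLaplace, gegenbauerDensity, normalizedGegenbauer_zero]

theorem gegenbauerLaplace_one {l : ℝ} (hl : 0 < l) (s : ℝ) :
    (2 * l + 1) * gegenbauerLaplace l 1 s = s * sinLaplace (2 * l + 1) s := by
  have hw := continuous_gegenbauerDensity hl 1
  have hS := continuous_sin_rpow (show 0 < 2 * l + 1 by positivity)
  have hd : ∀ θ, HasDerivAt (fun t => Real.exp (-s * t) * Real.sin t ^ (2 * l + 1))
      ((2 * l + 1) * (Real.exp (-s * θ) * gegenbauerDensity l 1 θ) -
        s * (Real.exp (-s * θ) * Real.sin θ ^ (2 * l + 1))) θ := by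
    intro θ
    refine ((hasDerivAt_exp_neg_mul s θ).mul
      ((Real.hasDerivAt_sin θ).rpow_const (p := 2 * l + 1) (Or.inr (by linarith)))).congr_deriv ?_
    simp only [gegenbauerDensity, normalizedGegenbauer_one hl, eval_X, add_sub_cancel_right]
    ring
  have h1 := intervalIntegrable_exp_neg_mul hw s 0 Real.pi
  have h2 := intervalIntegrable_exp_neg_mul hS s 0 Real.pi
  have := intervalIntegral.integral_eq_sub_of_hasDerivAt (fun θ _ => hd θ)
    ((h1.const_mul (2 * l + 1)).sub (h2.const_mul s))
  rw [intervalIntegral.integral_sub (h1.const_mul (2 * l + 1)) (h2.const_mul s),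
    intervalIntegral.integral_const_mul, intervalIntegral.integral_const_mul, Real.sin_pi,
    Real.sin_zero, Real.zero_rpow (by positivity)] at this
  simp only [gegenbauerLaplace, sinLaplace]
  linarith

theorem gegenbauerLaplace_add_two {l : ℝ} (hl : 0 < l) (n : ℕ) (s : ℝ) :
    (s ^ 2 + ((n : ℝ) + 2 + 2 * l) ^ 2) * gegenbauerLaplace l (n + 2) s =
      (s ^ 2 + (n : ℝ) ^ 2) * gegenbauerLaplace l n s := by
  have h0 := continuous_gegenbauerDensity hl n
  have h2 := continuous_gegenbauerDensity hl (n + 2)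
  have hv := continuous_densityGapDeriv hl n
  have hE := continuous_exp_neg_mul s
  set F : ℝ → ℝ := fun t => Real.exp (-s * t) * (densityGapDeriv l n t +
    s * (gegenbauerDensity l (n + 2) t - gegenbauerDensity l n t)) with hF
  have hFc : Continuous F := hE.mul (hv.add (continuous_const.mul (h2.sub h0)))
  have hd : ∀ θ ∈ Ioo 0 Real.pi, HasDerivAt F
      ((s ^ 2 + (n : ℝ) ^ 2) * (Real.exp (-s * θ) * gegenbauerDensity l n θ) -
        (s ^ 2 + ((n : ℝ) + 2 + 2 * l) ^ 2) *
          (Real.exp (-s * θ) * gegenbauerDensity l (n + 2) θ)) θ := by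
    intro θ hθ
    have hs := Real.sin_pos_of_mem_Ioo hθ
    refine ((hasDerivAt_exp_neg_mul s θ).mul ((hasDerivAt_densityGapDeriv hl n hs).add
      ((hasDerivAt_densityGap hl n hs).const_mul s))).congr_deriv ?_
    simp only [Pi.add_apply]
    ring
  have i0 := (intervalIntegrable_exp_neg_mul h0 s 0 Real.pi).const_mul
    (s ^ 2 + (n : ℝ) ^ 2)
  have i2 := (intervalIntegrable_exp_neg_mul h2 s 0 Real.pi).const_mul
    (s ^ 2 + ((n : ℝ) + 2 + 2 * l) ^ 2)
  have := intervalIntegral.integral_eq_sub_of_hasDerivAt_of_le Real.pi_pos.le hFc.continuousOn hd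
    (i0.sub i2)
  rw [intervalIntegral.integral_sub i0 i2, intervalIntegral.integral_const_mul,
    intervalIntegral.integral_const_mul] at this
  have hb : ∀ θ, Real.sin θ = 0 → F θ = 0 := by
    intro θ h
    simp only [hF, densityGapDeriv, gegenbauerDensity, h]
    rw [Real.zero_rpow (by positivity), Real.zero_rpow (by positivity)]
    ring
  rw [hb _ Real.sin_pi, hb _ Real.sin_zero] at this
  simp only [gegenbauerLaplace]
  linarith

theorem sinLaplace_integrand_nonneg (a s : ℝ) {θ : ℝ} (h : θ ∈ Icc 0 Real.pi) :
    0 ≤ Real.exp (-s * θ) * Real.sin θ ^ a :=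
  mul_nonneg (Real.exp_pos _).le (Real.rpow_nonneg (Real.sin_nonneg_of_mem_Icc h) _)

theorem sinLaplace_nonneg (a s : ℝ) : 0 ≤ sinLaplace a s :=
  intervalIntegral.integral_nonneg Real.pi_pos.le fun _ h => sinLaplace_integrand_nonneg a s h

theorem sinLaplace_le_pi {a s : ℝ} (ha : 0 < a) (hs : 0 ≤ s) : sinLaplace a s ≤ Real.pi := by
  have hc := (continuous_exp_neg_mul s).mul (continuous_sin_rpow ha)
  calc sinLaplace a s ≤ ∫ _ in (0 : ℝ)..Real.pi, (1 : ℝ) := by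
        refine intervalIntegral.integral_mono_on Real.pi_pos.le (hc.intervalIntegrable _ _)
          intervalIntegrable_const fun θ hθ => ?_
        refine mul_le_one₀ (Real.exp_le_one_iff.2 ?_)
          (Real.rpow_nonneg (Real.sin_nonneg_of_mem_Icc hθ) _)
          (Real.rpow_le_one (Real.sin_nonneg_of_mem_Icc hθ) (Real.sin_le_one θ) ha.le)
        nlinarith [mul_nonneg hs hθ.1]
    _ = Real.pi := by simp

theorem sinLaplace_le_rpow {a s : ℝ} (ha : 0 < a) (hs : 0 < s) :
    sinLaplace a s ≤ Real.Gamma (a + 1) * s ^ (-a - 1) := by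
  have hc := (continuous_exp_neg_mul s).mul (continuous_sin_rpow ha)
  have hI : IntegrableOn (fun t : ℝ => t ^ a * Real.exp (-s * t)) (Ioi 0) := by
    simpa using integrableOn_rpow_mul_exp_neg_mul_rpow (p := 1) (by linarith : -1 < a) one_pos hs
  have hG := Real.integral_rpow_mul_exp_neg_mul_Ioi (a := a + 1) (by linarith) hs
  rw [add_sub_cancel_right] at hG
  calc sinLaplace a s
      ≤ ∫ θ in (0 : ℝ)..Real.pi, θ ^ a * Real.exp (-s * θ) := by
        refine intervalIntegral.integral_mono_on Real.pi_pos.le (hc.intervalIntegrable _ _) ?_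
          fun θ hθ => ?_
        · exact (intervalIntegrable_iff_integrableOn_Ioc_of_le Real.pi_pos.le).2
            (hI.mono_set Ioc_subset_Ioi_self)
        · rw [mul_comm]
          exact mul_le_mul_of_nonneg_right (Real.rpow_le_rpow (Real.sin_nonneg_of_mem_Icc hθ)
            (Real.sin_le hθ.1) ha.le) (Real.exp_pos _).le
    _ ≤ ∫ θ in Ioi (0 : ℝ), θ ^ a * Real.exp (-s * θ) := by
        rw [intervalIntegral.integral_of_le Real.pi_pos.le]
        refine setIntegral_mono_set hI ?_ Ioc_subset_Ioi_self.eventuallyLE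
        filter_upwards [ae_restrict_mem measurableSet_Ioi] with t ht
        exact mul_nonneg (Real.rpow_nonneg (le_of_lt ht) _) (Real.exp_pos _).le
    _ = Real.Gamma (a + 1) * s ^ (-a - 1) := by
        simp only [neg_mul] at hG ⊢
        rw [hG, mul_comm, one_div, Real.inv_rpow hs.le, ← Real.rpow_neg hs.le]
        congr 2; ring

theorem exists_le_sinLaplace {a : ℝ} (ha : 0 < a) :
    ∃ c : ℝ, 0 < c ∧ ∀ s : ℝ, 1 ≤ s → c * s ^ (-a - 1) ≤ sinLaplace a s := by
  refine ⟨Real.exp (-1) * (2 / Real.pi) ^ a / (a + 1), by have := Real.pi_pos; positivity,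
    fun s hs => ?_⟩
  have hs0 : 0 < s := by linarith
  have hs1 : 1 / s ≤ 1 := by rw [div_le_one hs0]; exact hs
  have hpi : (1 : ℝ) ≤ Real.pi / 2 := Real.one_le_pi_div_two
  have hsi : 0 ≤ 1 / s := by positivity
  have hc := (continuous_exp_neg_mul s).mul (continuous_sin_rpow ha)
  have hE : sinLaplace a s ≥ ∫ θ in (0 : ℝ)..(1 / s), Real.exp (-s * θ) * Real.sin θ ^ a := by
    refine intervalIntegral.integral_mono_interval le_rfl hsi (by linarith) ?_
      (hc.intervalIntegrable _ _)
    filter_upwards [ae_restrict_mem measurableSet_Ioc] with t ht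
    exact sinLaplace_integrand_nonneg a s ⟨ht.1.le, ht.2⟩
  refine le_trans ?_ hE
  have hp : Continuous fun θ : ℝ => θ ^ a := continuous_id.rpow_const fun _ => Or.inr ha.le
  calc Real.exp (-1) * (2 / Real.pi) ^ a / (a + 1) * s ^ (-a - 1)
      = ∫ θ in (0 : ℝ)..(1 / s), Real.exp (-1) * (2 / Real.pi) ^ a * θ ^ a := by
        rw [intervalIntegral.integral_const_mul, integral_rpow (Or.inl (by linarith)),
          Real.zero_rpow (by positivity), one_div, Real.inv_rpow hs0.le, ← Real.rpow_neg hs0.le]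
        rw [show -(a + 1) = -a - 1 by ring]
        ring
    _ ≤ _ := by
        refine intervalIntegral.integral_mono_on hsi ((continuous_const.mul hp).intervalIntegrable _ _)
          (hc.intervalIntegrable _ _) fun θ hθ => ?_
        have h1 : 2 / Real.pi * θ ≤ Real.sin θ := Real.mul_le_sin hθ.1 (by linarith [hθ.2])
        rw [mul_assoc, ← Real.mul_rpow (by have := Real.pi_pos; positivity) hθ.1]
        have h0 : 0 ≤ 2 / Real.pi * θ := mul_nonneg (by have := Real.pi_pos; positivity) hθ.1
        have h2 : s * θ ≤ 1 := by
          have := hθ.2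
          rw [le_div_iff₀ hs0] at this
          linarith
        exact mul_le_mul (Real.exp_le_exp.2 (by linarith)) (Real.rpow_le_rpow h0 h1 ha.le)
          (Real.rpow_nonneg h0 _) (Real.exp_pos _).le

theorem gegenbauerLaplace_nonneg {l : ℝ} (hl : 0 < l) (n : ℕ) {s : ℝ} (hs : 0 ≤ s) :
    0 ≤ gegenbauerLaplace l n s := by
  induction n using Nat.twoStepInduction with
  | zero => rw [gegenbauerLaplace_zero]; exact sinLaplace_nonneg _ _
  | one =>
    refine nonneg_of_mul_nonneg_right (a := 2 * l + 1) ?_ (by positivity)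
    rw [gegenbauerLaplace_one hl]
    exact mul_nonneg hs (sinLaplace_nonneg _ _)
  | more n ih _ =>
    refine nonneg_of_mul_nonneg_right (a := s ^ 2 + ((n : ℝ) + 2 + 2 * l) ^ 2) ?_ (by positivity)
    rw [gegenbauerLaplace_add_two hl]
    positivity

theorem gegenbauerLaplace_apply_zero {l : ℝ} (hl : 0 < l) {n : ℕ} (hn : 1 ≤ n) :
    gegenbauerLaplace l n 0 = 0 := by
  induction n using Nat.twoStepInduction with
  | zero => omega
  | one =>
    have h := gegenbauerLaplace_one hl 0
    rw [zero_mul] at h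
    exact (mul_eq_zero.1 h).resolve_left (by positivity)
  | more n ih _ =>
    have h := gegenbauerLaplace_add_two hl n 0
    have h0 : ((0 : ℝ) ^ 2 + (n : ℝ) ^ 2) * gegenbauerLaplace l n 0 = 0 := by
      rcases Nat.eq_zero_or_pos n with rfl | hp
      · simp
      · rw [ih hp, mul_zero]
    rw [h0] at h
    exact (mul_eq_zero.1 h).resolve_left (by positivity)

theorem gegenbauerLaplace_add_two_le {l : ℝ} (hl : 0 < l) (n : ℕ) {s : ℝ} (hs : 0 ≤ s) :
    gegenbauerLaplace l (n + 2) s ≤ gegenbauerLaplace l n s := by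
  have h := gegenbauerLaplace_add_two hl n s
  have h0 := gegenbauerLaplace_nonneg hl n hs
  have hp : 0 < s ^ 2 + ((n : ℝ) + 2 + 2 * l) ^ 2 := by positivity
  refine le_of_mul_le_mul_left ?_ hp
  rw [h]
  refine mul_le_mul_of_nonneg_right ?_ h0
  have : (0 : ℝ) ≤ n := n.cast_nonneg
  nlinarith

/-- Convexity of `artanh` on `[0, 1)`, exponentiated. -/
theorem one_sub_mul_div_le_rpow {p y : ℝ} (hp : 1 ≤ p) (hy : 0 ≤ y) (hpy : p * y < 1) :
    (1 - p * y) / (1 + p * y) ≤ ((1 - y) / (1 + y)) ^ p := by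
  have hpy0 : 0 ≤ p * y := by positivity
  have hy1 : y ≤ p * y := by nlinarith
  have h1 := Real.hasSum_log_sub_log_of_abs_lt_one (x := y) (by rw [abs_of_nonneg hy]; linarith)
  have h2 := Real.hasSum_log_sub_log_of_abs_lt_one (x := p * y) (by rwa [abs_of_nonneg hpy0])
  have h3 := hasSum_le (fun k => ?_) (h1.mul_left p) h2
  · have a1 : 0 < 1 - y := by linarith
    have a2 : 0 < 1 + y := by linarith
    have a3 : 0 < 1 - p * y := by linarith
    have a4 : 0 < 1 + p * y := by linarith
    rw [← Real.log_le_log_iff (by positivity) (by positivity), Real.log_rpow (by positivity),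
      Real.log_div a3.ne' a4.ne', Real.log_div a1.ne' a2.ne']
    linarith
  · rw [mul_pow]
    have : p ≤ p ^ (2 * k + 1) := le_self_pow₀ hp (by omega)
    have hyk : 0 ≤ 2 * (1 / (2 * (k : ℝ) + 1)) * y ^ (2 * k + 1) := by positivity
    nlinarith [mul_le_mul_of_nonneg_right this hyk]

/-- The `(l + 1)`-st power of this weight compensates the decay of `gegenbauerLaplace` in `n`. -/
noncomputable def decayWeight (l : ℝ) (n : ℕ) (s : ℝ) : ℝ :=
  s ^ 2 + (l + 1) ^ 2 - 1 + ((n : ℝ) + l) ^ 2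

theorem sq_le_decayWeight {l : ℝ} (hl : 0 < l) (n : ℕ) (s : ℝ) :
    (n : ℝ) ^ 2 ≤ decayWeight l n s := by
  have : (0 : ℝ) ≤ n := n.cast_nonneg
  unfold decayWeight
  nlinarith [sq_nonneg s, mul_nonneg this hl.le]

theorem decayWeight_pos {l : ℝ} (hl : 0 < l) (n : ℕ) (s : ℝ) : 0 < decayWeight l n s := by
  have : (0 : ℝ) ≤ n := n.cast_nonneg
  unfold decayWeight
  nlinarith [sq_nonneg s, mul_nonneg this hl.le]

theorem factor_le_decayWeight_ratio {l : ℝ} (hl : 0 < l) {n : ℕ} (hn : 1 ≤ n) (s : ℝ) :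
    (s ^ 2 + (n : ℝ) ^ 2) / (s ^ 2 + ((n : ℝ) + 2 + 2 * l) ^ 2) ≤
      (decayWeight l n s / decayWeight l (n + 2) s) ^ (l + 1) := by
  have hn' : (1 : ℝ) ≤ n := by exact_mod_cast hn
  set M : ℝ := s ^ 2 + ((n : ℝ) + 1 + l) ^ 2 + (l + 1) ^ 2 with hM
  have hM0 : 0 < M := by positivity
  set y : ℝ := 2 * ((n : ℝ) + 1 + l) / M with hy
  have hyM : y * M = 2 * ((n : ℝ) + 1 + l) := by rw [hy]; field_simp
  have hy0 : 0 ≤ y := by positivity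
  have hpy : (l + 1) * y < 1 := by
    rw [hy, mul_div_assoc', div_lt_one hM0, hM]
    nlinarith [sq_nonneg s]
  have h := one_sub_mul_div_le_rpow (p := l + 1) (by linarith) hy0 hpy
  have e1 : (1 - (l + 1) * y) / (1 + (l + 1) * y) =
      (s ^ 2 + (n : ℝ) ^ 2) / (s ^ 2 + ((n : ℝ) + 2 + 2 * l) ^ 2) := by
    rw [← mul_div_mul_right _ _ hM0.ne']
    congr 1
    · linear_combination (-(l + 1)) * hyM + hM
    · linear_combination (l + 1) * hyM + hM
  have e2 : (1 - y) / (1 + y) = decayWeight l n s / decayWeight l (n + 2) s := by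
    rw [← mul_div_mul_right _ _ hM0.ne']
    unfold decayWeight
    push_cast
    congr 1
    · linear_combination -hyM + hM
    · linear_combination hyM + hM
  rwa [e1, e2] at h

theorem gegenbauerLaplace_mul_decayWeight_le {l : ℝ} (hl : 0 < l) {n : ℕ} (hn : 1 ≤ n) {s : ℝ}
    (hs : 0 ≤ s) :
    gegenbauerLaplace l (n + 2) s * decayWeight l (n + 2) s ^ (l + 1) ≤
      gegenbauerLaplace l n s * decayWeight l n s ^ (l + 1) := by
  have hp : 0 < s ^ 2 + ((n : ℝ) + 2 + 2 * l) ^ 2 := by positivity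
  have e : gegenbauerLaplace l (n + 2) s = (s ^ 2 + (n : ℝ) ^ 2) /
      (s ^ 2 + ((n : ℝ) + 2 + 2 * l) ^ 2) * gegenbauerLaplace l n s := by
    rw [div_mul_eq_mul_div, eq_div_iff hp.ne', ← gegenbauerLaplace_add_two hl]
    ring
  have h := factor_le_decayWeight_ratio hl hn s
  have hw := Real.rpow_pos_of_pos (decayWeight_pos hl (n + 2) s) (l + 1)
  rw [Real.div_rpow (decayWeight_pos hl _ _).le (decayWeight_pos hl _ _).le,
    le_div_iff₀ hw] at h
  rw [e]
  have := mul_le_mul_of_nonneg_right h (gegenbauerLaplace_nonneg hl n hs)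
  linarith

theorem decayWeight_le_of_le_one (l : ℝ) (n : ℕ) {s : ℝ} (hs : 0 ≤ s) (h : s ≤ 1) :
    decayWeight l n s ≤ decayWeight l n 1 := by
  unfold decayWeight
  nlinarith

theorem decayWeight_le_of_one_le {l : ℝ} (hl : 0 < l) (n : ℕ) {s : ℝ} (h : 1 ≤ s) :
    decayWeight l n s ≤ decayWeight l n 1 * s ^ 2 := by
  have h1 : 1 ≤ s ^ 2 := by nlinarith
  have h2 : 0 ≤ (l + 1) ^ 2 - 1 + ((n : ℝ) + l) ^ 2 := by nlinarith [sq_nonneg ((n : ℝ) + l)]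
  unfold decayWeight
  nlinarith [mul_le_mul_of_nonneg_left h1 h2]

theorem mul_decayWeight_rpow_le {l : ℝ} (hl : 0 < l) (n : ℕ) {K s A : ℝ} (hK : 0 ≤ K)
    (hs : 0 < s) (h1 : A ≤ K * s) (h2 : A ≤ K * s ^ (-(2 * l) - 1)) :
    A * decayWeight l n s ^ (l + 1) ≤ K * decayWeight l n 1 ^ (l + 1) * s := by
  have hw := decayWeight_pos hl n s
  have hw1 := decayWeight_pos hl n 1
  have hp : 0 ≤ l + 1 := by positivity
  have hwp : 0 ≤ decayWeight l n s ^ (l + 1) := by positivity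
  rcases le_total s 1 with h | h
  · calc A * decayWeight l n s ^ (l + 1) ≤ K * s * decayWeight l n s ^ (l + 1) := by gcongr
      _ ≤ K * s * decayWeight l n 1 ^ (l + 1) := by
          gcongr; exact decayWeight_le_of_le_one l n hs.le h
      _ = _ := by ring
  · calc A * decayWeight l n s ^ (l + 1)
        ≤ K * s ^ (-(2 * l) - 1) * decayWeight l n s ^ (l + 1) := by gcongr
      _ ≤ K * s ^ (-(2 * l) - 1) * (decayWeight l n 1 * s ^ 2) ^ (l + 1) := by
          gcongr; exact decayWeight_le_of_one_le hl n h
      _ = K * decayWeight l n 1 ^ (l + 1) * s := by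
          have e : s ^ (-(2 * l) - 1) * s ^ ((2 : ℝ) * (l + 1)) = s := by
            rw [← Real.rpow_add hs]
            conv_rhs => rw [← Real.rpow_one s]
            congr 1; ring
          rw [Real.mul_rpow hw1.le (by positivity), ← Real.rpow_natCast s 2,
            ← Real.rpow_mul hs.le, Nat.cast_ofNat]
          linear_combination K * decayWeight l n 1 ^ (l + 1) * e

theorem exists_gegenbauerLaplace_one_two_le {l : ℝ} (hl : 0 < l) :
    ∃ K : ℝ, 0 < K ∧ ∀ s : ℝ, 0 < s →
      (gegenbauerLaplace l 1 s ≤ K * s ∧ gegenbauerLaplace l 1 s ≤ K * s ^ (-(2 * l) - 1)) ∧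
      (gegenbauerLaplace l 2 s ≤ K * s ∧ gegenbauerLaplace l 2 s ≤ K * s ^ (-(2 * l) - 1)) := by
  have hG1 := Real.Gamma_pos_of_pos (show 0 < 2 * l + 1 by positivity)
  have hG2 := Real.Gamma_pos_of_pos (show 0 < 2 * l + 1 + 1 by positivity)
  set K := Real.pi + Real.Gamma (2 * l + 1) + Real.Gamma (2 * l + 1 + 1)
  have hpi := Real.pi_pos
  refine ⟨K, by positivity, fun s hs => ?_⟩
  have hr : 0 < s ^ (-(2 * l) - 1) := by positivity
  have e1 := gegenbauerLaplace_one hl s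
  have n1 := gegenbauerLaplace_nonneg hl 1 hs.le
  have f1 : gegenbauerLaplace l 1 s ≤ s * sinLaplace (2 * l + 1) s := by
    rw [← e1]; nlinarith [mul_nonneg hl.le n1]
  have b1 := sinLaplace_le_pi (show 0 < 2 * l + 1 by positivity) hs.le
  have b2 := sinLaplace_le_rpow (show 0 < 2 * l + 1 by positivity) hs
  have b3 := sinLaplace_le_pi (show 0 < 2 * l by positivity) hs.le
  have b4 := sinLaplace_le_rpow (show 0 < 2 * l by positivity) hs
  have n0 := sinLaplace_nonneg (2 * l) s
  have e2 := gegenbauerLaplace_add_two hl 0 s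
  have n2 := gegenbauerLaplace_nonneg hl 2 hs.le
  have f2 := gegenbauerLaplace_add_two_le hl 0 hs.le
  rw [gegenbauerLaplace_zero] at e2 f2
  simp only [zero_add, Nat.cast_zero] at e2 f2
  refine ⟨⟨?_, ?_⟩, ?_, ?_⟩
  · calc _ ≤ s * sinLaplace (2 * l + 1) s := f1
      _ ≤ s * K := by gcongr; simp only [K]; linarith
      _ = _ := mul_comm _ _
  · calc _ ≤ s * sinLaplace (2 * l + 1) s := f1
      _ ≤ s * (Real.Gamma (2 * l + 1 + 1) * s ^ (-(2 * l + 1) - 1)) := by gcongr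
      _ = Real.Gamma (2 * l + 1 + 1) * s ^ (-(2 * l) - 1) := by
          have e : s ^ (-(2 * l) - 1) = s ^ (-(2 * l + 1) - 1) * s := by
            rw [← Real.rpow_add_one hs.ne']; congr 1; ring
          rw [e]; ring
      _ ≤ _ := by gcongr; simp only [K]; linarith
  · have h4 : s ^ 2 ≤ s * (s ^ 2 + (2 + 2 * l) ^ 2) := by
      have : s ≤ s ^ 2 + (2 + 2 * l) ^ 2 := by nlinarith [sq_nonneg (s - 1)]
      nlinarith
    have hq : 0 < s ^ 2 + (2 + 2 * l) ^ 2 := by positivity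
    refine le_of_mul_le_mul_left ?_ hq
    calc (s ^ 2 + (2 + 2 * l) ^ 2) * gegenbauerLaplace l 2 s = s ^ 2 * sinLaplace (2 * l) s := by
          rw [e2]; ring
      _ ≤ s * (s ^ 2 + (2 + 2 * l) ^ 2) * K := by
          gcongr; simp only [K]; linarith
      _ = _ := by ring
  · calc _ ≤ sinLaplace (2 * l) s := f2
      _ ≤ _ := b4
      _ ≤ _ := by gcongr; simp only [K]; linarith

theorem exists_gegenbauerLaplace_le {l : ℝ} (hl : 0 < l) :
    ∃ K : ℝ, 0 < K ∧ ∀ n : ℕ, 1 ≤ n → ∀ s : ℝ, 0 < s →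
      gegenbauerLaplace l n s ≤ K * s ^ (-(2 * l) - 1) ∧
      gegenbauerLaplace l n s ≤ K * (n : ℝ) ^ (-(2 * l) - 2) * s := by
  obtain ⟨K, hK, hb⟩ := exists_gegenbauerLaplace_one_two_le hl
  have hw1 := decayWeight_pos hl 1 1
  have hw2 := decayWeight_pos hl 2 1
  set L := K * decayWeight l 1 1 ^ (l + 1) + K * decayWeight l 2 1 ^ (l + 1)
  have hL : 0 < L := by positivity
  have hpow : ∀ n : ℕ, ∀ s : ℝ, 0 < s → gegenbauerLaplace l (n + 1) s ≤ K * s ^ (-(2 * l) - 1) ∧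
      gegenbauerLaplace l (n + 1) s * decayWeight l (n + 1) s ^ (l + 1) ≤ L * s := by
    intro n s hs
    obtain ⟨⟨a1, a2⟩, a3, a4⟩ := hb s hs
    induction n using Nat.twoStepInduction with
    | zero =>
      refine ⟨a2, (mul_decayWeight_rpow_le hl 1 hK.le hs a1 a2).trans ?_⟩
      gcongr
      exact le_add_of_nonneg_right (by positivity)
    | one =>
      refine ⟨a4, (mul_decayWeight_rpow_le hl 2 hK.le hs a3 a4).trans ?_⟩
      gcongr
      exact le_add_of_nonneg_left (by positivity)
    | more n ih _ =>
      exact ⟨(gegenbauerLaplace_add_two_le hl (n + 1) hs.le).trans ih.1,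
        (gegenbauerLaplace_mul_decayWeight_le hl (by omega) hs.le).trans ih.2⟩
  refine ⟨K + L, by positivity, fun n hn s hs => ?_⟩
  obtain ⟨m, rfl⟩ : ∃ m, n = m + 1 := ⟨n - 1, by omega⟩
  obtain ⟨h1, h2⟩ := hpow m s hs
  have hn0 : (0 : ℝ) < ((m + 1 : ℕ) : ℝ) := by positivity
  set N : ℝ := ((m + 1 : ℕ) : ℝ)
  constructor
  · refine h1.trans ?_
    gcongr
    linarith
  · have h3 : N ^ ((2 : ℝ) * (l + 1)) ≤ decayWeight l (m + 1) s ^ (l + 1) := by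
      rw [Real.rpow_mul hn0.le]
      refine Real.rpow_le_rpow (by positivity) ?_ (by positivity)
      rw [Real.rpow_two]
      exact sq_le_decayWeight hl (m + 1) s
    have h4 : gegenbauerLaplace l (m + 1) s * N ^ ((2 : ℝ) * (l + 1)) ≤ (K + L) * s := by
      refine (mul_le_mul_of_nonneg_left h3 (gegenbauerLaplace_nonneg hl _ hs.le)).trans
        (h2.trans ?_)
      gcongr
      linarith
    have e : N ^ ((2 : ℝ) * (l + 1)) * N ^ (-(2 * l) - 2) = 1 := by
      rw [← Real.rpow_add hn0, show (2 : ℝ) * (l + 1) + (-(2 * l) - 2) = 0 by ring,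
        Real.rpow_zero]
    have h5 := mul_le_mul_of_nonneg_right h4 (show 0 ≤ N ^ (-(2 * l) - 2) by positivity)
    rw [mul_assoc, e, mul_one] at h5
    linarith

theorem exists_le_gegenbauerLaplace_zero_one {l : ℝ} (hl : 0 < l) :
    ∃ c : ℝ, 0 < c ∧ ∀ s : ℝ, 1 ≤ s → c * s ^ (-(2 * l) - 1) ≤ gegenbauerLaplace l 0 s ∧
      c * s ^ (-(2 * l) - 1) ≤ gegenbauerLaplace l 1 s := by
  obtain ⟨c0, hc0, h0⟩ := exists_le_sinLaplace (show 0 < 2 * l by positivity)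
  obtain ⟨c1, hc1, h1⟩ := exists_le_sinLaplace (show 0 < 2 * l + 1 by positivity)
  refine ⟨min c0 (c1 / (2 * l + 1)), by positivity, fun s hs => ?_⟩
  have hs0 : 0 < s := by linarith
  have hr : 0 < s ^ (-(2 * l) - 1) := by positivity
  constructor
  · rw [gegenbauerLaplace_zero]
    refine le_trans ?_ (h0 s hs)
    gcongr
    exact min_le_left _ _
  · have hp : 0 < 2 * l + 1 := by positivity
    have e : s ^ (-(2 * l) - 1) = s ^ (-(2 * l + 1) - 1) * s := by
      rw [← Real.rpow_add_one hs0.ne']; congr 1; ring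
    calc _ ≤ c1 / (2 * l + 1) * s ^ (-(2 * l) - 1) := by gcongr; exact min_le_right _ _
      _ ≤ _ := by
        rw [div_mul_eq_mul_div, div_le_iff₀ hp, mul_comm (gegenbauerLaplace l 1 s),
          gegenbauerLaplace_one hl, e]
        have := mul_le_mul_of_nonneg_left (h1 s hs) hs0.le
        linarith

theorem exists_le_gegenbauerLaplace {l : ℝ} (hl : 0 < l) :
    ∃ c : ℝ, 0 < c ∧ ∀ n : ℕ, 1 ≤ n → ∀ s : ℝ, (n : ℝ) ≤ s →
      c * s ^ (-(2 * l) - 1) ≤ gegenbauerLaplace l n s := by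
  obtain ⟨c, hc, hb⟩ := exists_le_gegenbauerLaplace_zero_one hl
  set B := 4 * (l + 1) + 4 * (l + 1) ^ 2 with hB
  have hB0 : 0 < B := by positivity
  refine ⟨c * Real.exp (-B), by positivity, fun n hn s hs => ?_⟩
  have hn' : (1 : ℝ) ≤ n := by exact_mod_cast hn
  have hn0 : (0 : ℝ) < n := by linarith
  have hs0 : 0 < s := by linarith
  obtain ⟨b0, b1⟩ := hb s (hn'.trans hs)
  have hr : 0 < s ^ (-(2 * l) - 1) := by positivity
  have hq : 1 ≤ 1 + B / n := le_add_of_nonneg_right (by positivity)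
  have key : ∀ k : ℕ, k ≤ n →
      c * s ^ (-(2 * l) - 1) ≤ gegenbauerLaplace l k s * (1 + B / n) ^ k := by
    intro k
    induction k using Nat.twoStepInduction with
    | zero => intro _; simpa using b0
    | one =>
      intro _
      rw [pow_one]
      exact b1.trans (le_mul_of_one_le_right (gegenbauerLaplace_nonneg hl 1 hs0.le) hq)
    | more k ih _ =>
      intro hk
      refine (ih (by omega)).trans ?_
      have hk' : (k : ℝ) ≤ n := by exact_mod_cast (by omega : k ≤ n)
      have hk0 : (0 : ℝ) ≤ k := k.cast_nonneg
      have e := gegenbauerLaplace_add_two hl k s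
      have n2 := gegenbauerLaplace_nonneg hl (k + 2) hs0.le
      have n0 := gegenbauerLaplace_nonneg hl k hs0.le
      have hstep : s ^ 2 + ((k : ℝ) + 2 + 2 * l) ^ 2 ≤ (s ^ 2 + (k : ℝ) ^ 2) * (1 + B / n) := by
        have h1 : B * n ≤ s ^ 2 * (B / n) := by
          rw [mul_div_assoc', le_div_iff₀ hn0]
          have : (n : ℝ) ^ 2 ≤ s ^ 2 := by gcongr
          nlinarith
        have h2 : 0 ≤ (k : ℝ) ^ 2 * (B / n) := by positivity
        have h3 : 4 * (l + 1) * k + 4 * (l + 1) ^ 2 ≤ B * n := by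
          have := mul_le_mul_of_nonneg_left hk' (show 0 ≤ 4 * (l + 1) by positivity)
          have := mul_le_mul_of_nonneg_left hn' (show 0 ≤ 4 * (l + 1) ^ 2 by positivity)
          rw [hB]; linarith
        linarith
      have hpos : 0 < s ^ 2 + (k : ℝ) ^ 2 := by positivity
      have h4 : gegenbauerLaplace l k s ≤ gegenbauerLaplace l (k + 2) s * (1 + B / n) := by
        refine le_of_mul_le_mul_left ?_ hpos
        rw [← e]
        calc _ ≤ (s ^ 2 + (k : ℝ) ^ 2) * (1 + B / n) * gegenbauerLaplace l (k + 2) s := by gcongr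
          _ = _ := by ring
      calc gegenbauerLaplace l k s * (1 + B / n) ^ k
          ≤ gegenbauerLaplace l (k + 2) s * (1 + B / n) * (1 + B / n) ^ k := by gcongr
        _ ≤ gegenbauerLaplace l (k + 2) s * (1 + B / n) * (1 + B / n) ^ k * (1 + B / n) :=
            le_mul_of_one_le_right (by positivity) hq
        _ = _ := by ring
  have hexp : (1 + B / n) ^ n ≤ Real.exp B := by
    calc (1 + B / n) ^ n ≤ Real.exp (B / n) ^ n := by
          gcongr
          linarith [Real.add_one_le_exp (B / n)]
      _ = Real.exp B := by rw [← Real.exp_nat_mul]; congr 1; field_simp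
  have h1 := (key n le_rfl).trans (mul_le_mul_of_nonneg_left hexp
    (gegenbauerLaplace_nonneg hl n hs0.le))
  rw [Real.exp_neg, mul_right_comm, ← div_eq_mul_inv, div_le_iff₀ (Real.exp_pos _)]
  exact h1

/-- The kernel whose dilates represent `θ ^ δ` as a mixture of the functions `1 - exp (-s θ)`. -/
noncomputable def subordinationKernel (δ u : ℝ) : ℝ := (1 - Real.exp (-u)) * u ^ (-1 - δ)

theorem subordinationKernel_pos {δ u : ℝ} (hu : 0 < u) : 0 < subordinationKernel δ u :=
  mul_pos (sub_pos.2 (Real.exp_lt_one_iff.2 (by linarith))) (Real.rpow_pos_of_pos hu _)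

theorem measurable_subordinationKernel (δ : ℝ) : Measurable (subordinationKernel δ) := by
  unfold subordinationKernel
  fun_prop

theorem integrableOn_subordinationKernel {δ : ℝ} (h0 : 0 < δ) (h1 : δ < 1) :
    IntegrableOn (subordinationKernel δ) (Ioi 0) := by
  rw [← Ioc_union_Ioi_eq_Ioi zero_le_one]
  refine IntegrableOn.union ?_ ?_
  · have hI : IntegrableOn (fun u : ℝ => u ^ (-δ)) (Ioc 0 1) :=
      (intervalIntegrable_iff_integrableOn_Ioc_of_le zero_le_one).1
        (intervalIntegral.intervalIntegrable_rpow' (by linarith))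
    refine hI.mono' (measurable_subordinationKernel δ).aestronglyMeasurable ?_
    filter_upwards [ae_restrict_mem measurableSet_Ioc] with u hu
    rw [Real.norm_of_nonneg (subordinationKernel_pos hu.1).le, subordinationKernel,
      show -δ = 1 + (-1 - δ) by ring, Real.rpow_add hu.1, Real.rpow_one]
    refine mul_le_mul_of_nonneg_right ?_ (Real.rpow_nonneg hu.1.le _)
    linarith [Real.add_one_le_exp (-u)]
  · have hI : IntegrableOn (fun u : ℝ => u ^ (-1 - δ)) (Ioi 1) :=
      integrableOn_Ioi_rpow_of_lt (by linarith) one_pos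
    refine hI.mono' (measurable_subordinationKernel δ).aestronglyMeasurable ?_
    filter_upwards [ae_restrict_mem measurableSet_Ioi] with u hu
    have hu0 : 0 < u := one_pos.trans hu
    rw [Real.norm_of_nonneg (subordinationKernel_pos hu0).le, subordinationKernel]
    refine mul_le_of_le_one_left (Real.rpow_nonneg hu0.le _) ?_
    linarith [Real.exp_pos (-u)]

theorem integral_subordinationKernel_pos {δ : ℝ} (h0 : 0 < δ) (h1 : δ < 1) :
    0 < ∫ u in Ioi 0, subordinationKernel δ u := by
  rw [setIntegral_pos_iff_support_of_nonneg_ae]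
  · have : Ioi 0 ⊆ Function.support (subordinationKernel δ) := fun u hu =>
      (subordinationKernel_pos hu).ne'
    rw [inter_eq_self_of_subset_right this]
    simp
  · filter_upwards [ae_restrict_mem measurableSet_Ioi] with u hu
    exact (subordinationKernel_pos hu).le
  · exact integrableOn_subordinationKernel h0 h1

theorem one_sub_exp_mul_rpow_eq {δ s θ : ℝ} (hs : 0 < s) (hθ : 0 < θ) :
    (1 - Real.exp (-s * θ)) * s ^ (-1 - δ) = θ ^ (1 + δ) * subordinationKernel δ (s * θ) := by
  rw [subordinationKernel, Real.mul_rpow hs.le hθ.le, neg_mul]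
  have : θ ^ (1 + δ) * θ ^ (-1 - δ) = 1 := by
    rw [← Real.rpow_add hθ, show 1 + δ + (-1 - δ) = 0 by ring, Real.rpow_zero]
  linear_combination (-(1 - Real.exp (-(s * θ))) * s ^ (-1 - δ)) * this

theorem integral_one_sub_exp_mul_rpow (δ : ℝ) {θ : ℝ} (hθ : 0 < θ) :
    ∫ s in Ioi 0, (1 - Real.exp (-s * θ)) * s ^ (-1 - δ) =
      θ ^ δ * ∫ u in Ioi 0, subordinationKernel δ u := by
  rw [setIntegral_congr_fun measurableSet_Ioi
    (fun s hs => one_sub_exp_mul_rpow_eq (δ := δ) (mem_Ioi.1 hs) hθ), integral_const_mul,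
    integral_comp_mul_right_Ioi _ _ hθ, zero_mul, smul_eq_mul, Real.rpow_add hθ, Real.rpow_one]
  field_simp

theorem integrableOn_one_sub_exp_mul_rpow {δ : ℝ} (h0 : 0 < δ) (h1 : δ < 1) {θ : ℝ} (hθ : 0 < θ) :
    IntegrableOn (fun s => (1 - Real.exp (-s * θ)) * s ^ (-1 - δ)) (Ioi 0) := by
  rw [integrableOn_congr_fun (fun s hs => one_sub_exp_mul_rpow_eq (δ := δ) (mem_Ioi.1 hs) hθ)
    measurableSet_Ioi]
  have := (integrableOn_Ioi_comp_mul_right_iff (subordinationKernel δ) 0 hθ).2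
    (by simpa using integrableOn_subordinationKernel h0 h1)
  exact this.const_mul _

theorem integrable_subordination_prod {δ : ℝ} (h0 : 0 < δ) (h1 : δ < 1) {f : ℝ → ℝ}
    (hf : Continuous f) :
    Integrable (Function.uncurry fun θ s : ℝ => (1 - Real.exp (-s * θ)) * s ^ (-1 - δ) * f θ)
      ((volume.restrict (Ioc 0 Real.pi)).prod (volume.restrict (Ioi 0))) := by
  have hfi : Integrable f (volume.restrict (Ioc 0 Real.pi)) :=
    (intervalIntegrable_iff_integrableOn_Ioc_of_le Real.pi_pos.le).1 (hf.intervalIntegrable _ _)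
  refine (hfi.mul_prod (integrableOn_one_sub_exp_mul_rpow h0 h1 Real.pi_pos)).mono ?_ ?_
  · have := hf.measurable
    exact Measurable.aestronglyMeasurable (by unfold Function.uncurry; fun_prop)
  · rw [Measure.prod_restrict]
    filter_upwards [ae_restrict_mem (measurableSet_Ioc.prod measurableSet_Ioi)] with z hz
    obtain ⟨hz1, hz2⟩ := hz
    have hs : 0 < z.2 := hz2
    simp only [Function.uncurry, norm_mul]
    rw [mul_comm]
    have a1 : 0 ≤ 1 - Real.exp (-z.2 * z.1) := by
      rw [sub_nonneg, Real.exp_le_one_iff]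
      nlinarith [mul_pos hs hz1.1]
    have a2 : 1 - Real.exp (-z.2 * z.1) ≤ 1 - Real.exp (-z.2 * Real.pi) := by
      gcongr 1 - Real.exp ?_
      nlinarith [mul_le_mul_of_nonneg_left hz1.2 hs.le]
    gcongr
    rw [Real.norm_of_nonneg a1, Real.norm_of_nonneg (a1.trans a2)]
    exact a2

theorem integral_one_sub_exp_mul_gegenbauerDensity {l : ℝ} (hl : 0 < l) {n : ℕ} (hn : 1 ≤ n)
    (δ s : ℝ) :
    ∫ θ in Ioc 0 Real.pi, (1 - Real.exp (-s * θ)) * s ^ (-1 - δ) * gegenbauerDensity l n θ =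
      -(s ^ (-1 - δ) * gegenbauerLaplace l n s) := by
  have hw := continuous_gegenbauerDensity hl n
  have h0 := gegenbauerLaplace_apply_zero hl hn
  simp only [gegenbauerLaplace, neg_zero, zero_mul, Real.exp_zero, one_mul] at h0
  rw [← intervalIntegral.integral_of_le Real.pi_pos.le, gegenbauerLaplace]
  calc _ = ∫ θ in (0 : ℝ)..Real.pi, s ^ (-1 - δ) *
        (gegenbauerDensity l n θ - Real.exp (-s * θ) * gegenbauerDensity l n θ) := by
        congr 1; ext θ; ring
    _ = _ := by
        rw [intervalIntegral.integral_const_mul,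
          intervalIntegral.integral_sub (hw.intervalIntegrable _ _)
            (intervalIntegrable_exp_neg_mul hw s _ _), h0]
        ring

theorem integrableOn_rpow_mul_gegenbauerLaplace {l δ : ℝ} (hl : 0 < l) (h0 : 0 < δ) (h1 : δ < 1)
    {n : ℕ} (hn : 1 ≤ n) :
    IntegrableOn (fun s => s ^ (-1 - δ) * gegenbauerLaplace l n s) (Ioi 0) := by
  have h := (integrable_subordination_prod h0 h1
    (continuous_gegenbauerDensity hl n)).integral_prod_right
  simp only [Function.uncurry, integral_one_sub_exp_mul_gegenbauerDensity hl hn] at h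
  simpa [IntegrableOn] using h.neg

theorem neg_integral_rpow_mul_gegenbauerDensity {l δ : ℝ} (hl : 0 < l) (h0 : 0 < δ) (h1 : δ < 1)
    {n : ℕ} (hn : 1 ≤ n) :
    (∫ u in Ioi 0, subordinationKernel δ u) *
        -∫ θ in (0 : ℝ)..Real.pi, θ ^ δ * gegenbauerDensity l n θ =
      ∫ s in Ioi 0, s ^ (-1 - δ) * gegenbauerLaplace l n s := by
  have h := integral_integral_swap (integrable_subordination_prod h0 h1
    (continuous_gegenbauerDensity hl n))
  simp only [integral_one_sub_exp_mul_gegenbauerDensity hl hn, integral_mul_const,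
    integral_neg] at h
  rw [setIntegral_congr_fun measurableSet_Ioc (fun θ hθ => by
    rw [integral_one_sub_exp_mul_rpow δ (mem_Ioc.1 hθ).1, mul_right_comm])] at h
  rw [integral_mul_const, ← intervalIntegral.integral_of_le Real.pi_pos.le] at h
  linarith

theorem exists_integral_rpow_mul_gegenbauerLaplace_le {l δ : ℝ} (hl : 0 < l) (h0 : 0 < δ)
    (h1 : δ < 1) :
    ∃ C : ℝ, 0 < C ∧ ∀ n : ℕ, 1 ≤ n →
      ∫ s in Ioi 0, s ^ (-1 - δ) * gegenbauerLaplace l n s ≤ C * (n : ℝ) ^ (-2 * l - 1 - δ) := by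
  obtain ⟨K, hK, hb⟩ := exists_gegenbauerLaplace_le hl
  have hd : 0 < 1 - δ := by linarith
  refine ⟨K / (1 - δ) + K / (2 * l + 1 + δ), by positivity, fun n hn => ?_⟩
  have hn0 : (0 : ℝ) < n := by exact_mod_cast hn
  have hI := integrableOn_rpow_mul_gegenbauerLaplace hl h0 h1 hn
  have hJ1 : IntegrableOn (fun s : ℝ => s ^ (-δ)) (Ioc 0 n) :=
    (intervalIntegrable_iff_integrableOn_Ioc_of_le hn0.le).1
      (intervalIntegral.intervalIntegrable_rpow' (by linarith))
  have hJ2 : IntegrableOn (fun s : ℝ => s ^ (-2 * l - 2 - δ)) (Ioi n) :=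
    integrableOn_Ioi_rpow_of_lt (by linarith) hn0
  rw [← Ioc_union_Ioi_eq_Ioi hn0.le, setIntegral_union (Ioc_disjoint_Ioi le_rfl) measurableSet_Ioi
    (hI.mono_set Ioc_subset_Ioi_self) (hI.mono_set (Ioi_subset_Ioi hn0.le)), add_mul]
  refine add_le_add ?_ ?_
  · calc _ ≤ ∫ s in Ioc 0 (n : ℝ), K * (n : ℝ) ^ (-(2 * l) - 2) * s ^ (-δ) := by
          refine setIntegral_mono_on (hI.mono_set Ioc_subset_Ioi_self) (hJ1.const_mul _)
            measurableSet_Ioc fun s hs => ?_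
          have e : s ^ (-δ) = s ^ (-1 - δ) * s := by
            rw [← Real.rpow_add_one hs.1.ne']; congr 1; ring
          have := mul_le_mul_of_nonneg_left (hb n hn s hs.1).2 (Real.rpow_nonneg hs.1.le (-1 - δ))
          rw [e]
          linarith
      _ = K / (1 - δ) * (n : ℝ) ^ (-2 * l - 1 - δ) := by
          have e : (n : ℝ) ^ (-2 * l - 1 - δ) = (n : ℝ) ^ (-(2 * l) - 2) * (n : ℝ) ^ (1 - δ) := by
            rw [← Real.rpow_add hn0]; congr 1; ring
          rw [integral_const_mul, ← intervalIntegral.integral_of_le hn0.le,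
            integral_rpow (Or.inl (by linarith)), Real.zero_rpow (by linarith),
            show -δ + 1 = 1 - δ by ring, e]
          ring
  · calc _ ≤ ∫ s in Ioi (n : ℝ), K * s ^ (-2 * l - 2 - δ) := by
          refine setIntegral_mono_on (hI.mono_set (Ioi_subset_Ioi hn0.le)) (hJ2.const_mul _)
            measurableSet_Ioi fun s hs => ?_
          have hs0 : 0 < s := hn0.trans hs
          have e : s ^ (-2 * l - 2 - δ) = s ^ (-1 - δ) * s ^ (-(2 * l) - 1) := by
            rw [← Real.rpow_add hs0]; congr 1; ring
          have := mul_le_mul_of_nonneg_left (hb n hn s hs0).1 (Real.rpow_nonneg hs0.le (-1 - δ))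
          rw [e]
          linarith
      _ = K / (2 * l + 1 + δ) * (n : ℝ) ^ (-2 * l - 1 - δ) := by
          rw [integral_const_mul, integral_Ioi_rpow_of_lt (by linarith) hn0,
            show -2 * l - 2 - δ + 1 = -2 * l - 1 - δ by ring, neg_div, ← div_neg,
            show -(-2 * l - 1 - δ) = 2 * l + 1 + δ by ring]
          ring

theorem exists_le_integral_rpow_mul_gegenbauerLaplace {l δ : ℝ} (hl : 0 < l) (h0 : 0 < δ)
    (h1 : δ < 1) :
    ∃ c : ℝ, 0 < c ∧ ∀ n : ℕ, 1 ≤ n → c * (n : ℝ) ^ (-2 * l - 1 - δ) ≤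
      ∫ s in Ioi 0, s ^ (-1 - δ) * gegenbauerLaplace l n s := by
  obtain ⟨c, hc, hb⟩ := exists_le_gegenbauerLaplace hl
  have hp : 0 < 2 * l + 1 + δ := by positivity
  refine ⟨c / (2 * l + 1 + δ), by positivity, fun n hn => ?_⟩
  have hn0 : (0 : ℝ) < n := by exact_mod_cast hn
  have hI := integrableOn_rpow_mul_gegenbauerLaplace hl h0 h1 hn
  have hJ : IntegrableOn (fun s : ℝ => s ^ (-2 * l - 2 - δ)) (Ioi n) :=
    integrableOn_Ioi_rpow_of_lt (by linarith) hn0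
  calc c / (2 * l + 1 + δ) * (n : ℝ) ^ (-2 * l - 1 - δ)
      = ∫ s in Ioi (n : ℝ), c * s ^ (-2 * l - 2 - δ) := by
        rw [integral_const_mul, integral_Ioi_rpow_of_lt (by linarith) hn0,
          show -2 * l - 2 - δ + 1 = -2 * l - 1 - δ by ring, neg_div, ← div_neg,
          show -(-2 * l - 1 - δ) = 2 * l + 1 + δ by ring]
        ring
    _ ≤ ∫ s in Ioi (n : ℝ), s ^ (-1 - δ) * gegenbauerLaplace l n s := by
        refine setIntegral_mono_on (hJ.const_mul _) (hI.mono_set (Ioi_subset_Ioi hn0.le))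
          measurableSet_Ioi fun s hs => ?_
        have hs0 : 0 < s := hn0.trans hs
        have e : s ^ (-2 * l - 2 - δ) = s ^ (-1 - δ) * s ^ (-(2 * l) - 1) := by
          rw [← Real.rpow_add hs0]; congr 1; ring
        have := mul_le_mul_of_nonneg_left (hb n hn s (le_of_lt hs))
          (Real.rpow_nonneg hs0.le (-1 - δ))
        rw [e]
        linarith
    _ ≤ _ := by
        refine setIntegral_mono_set hI ?_ (Ioi_subset_Ioi hn0.le).eventuallyLE
        filter_upwards [ae_restrict_mem measurableSet_Ioi] with s hs
        exact mul_nonneg (Real.rpow_nonneg (le_of_lt hs) _)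
          (gegenbauerLaplace_nonneg hl n (le_of_lt hs))

/-- for `λ > 0` and `0 < δ < 1` there are constants `0 < c ≤ C` with
`c n^(-2λ-1-δ) ≤ -∫_0^π θ^δ (C_n^λ(cos θ)/C_n^λ(1)) (sin θ)^(2λ) dθ ≤ C n^(-2λ-1-δ)`
for all `n ≥ 1`. -/
theorem gegenbauer_geodesic_coefficient_asymptotics (l δ : ℝ) (hl : 0 < l)
    (hδ0 : 0 < δ) (hδ1 : δ < 1) :
    ∃ c C : ℝ, 0 < c ∧ c ≤ C ∧
      ∀ n : ℕ, 1 ≤ n →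
        c * (n : ℝ) ^ (-2 * l - 1 - δ) ≤
          -∫ θ in (0:ℝ)..Real.pi,
              θ ^ δ * ((gegenbauer l n).eval (Real.cos θ) / (gegenbauer l n).eval 1) *
                (Real.sin θ) ^ (2 * l) ∧
        -∫ θ in (0:ℝ)..Real.pi,
              θ ^ δ * ((gegenbauer l n).eval (Real.cos θ) / (gegenbauer l n).eval 1) *
                (Real.sin θ) ^ (2 * l) ≤
          C * (n : ℝ) ^ (-2 * l - 1 - δ) := by
  obtain ⟨c, hc, hlow⟩ := exists_le_integral_rpow_mul_gegenbauerLaplace hl hδ0 hδ1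
  obtain ⟨C, hC, hupp⟩ := exists_integral_rpow_mul_gegenbauerLaplace_le hl hδ0 hδ1
  have hG := integral_subordinationKernel_pos hδ0 hδ1
  set G := ∫ u in Ioi 0, subordinationKernel δ u
  refine ⟨c / G, C / G, by positivity, ?_, fun n hn => ?_⟩
  · have h := (hlow 1 le_rfl).trans (hupp 1 le_rfl)
    simp only [Nat.cast_one, Real.one_rpow, mul_one] at h
    gcongr
  · have e : ∀ θ : ℝ, θ ^ δ * ((gegenbauer l n).eval (Real.cos θ) / (gegenbauer l n).eval 1) *
        (Real.sin θ) ^ (2 * l) = θ ^ δ * gegenbauerDensity l n θ := by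
      intro θ
      simp only [gegenbauerDensity, normalizedGegenbauer, eval_mul, eval_C]
      ring
    simp only [e]
    have h := neg_integral_rpow_mul_gegenbauerDensity hl hδ0 hδ1 hn
    rw [div_mul_eq_mul_div, div_le_iff₀ hG, div_mul_eq_mul_div, le_div_iff₀ hG, mul_comm _ G, h]
    exact ⟨hlow n hn, hupp n hn⟩
end
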